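/- arXiv:1902.07614 — 4 statements merged into one kernel-verified Lean document; each statement's English description precedes it below -/
import Mathlib

section
/- For every integer k ≥ 3 and every real c > 0, there exists n₀ ∈ ℕ such that for every finite group Γ with |Γ| ≥ n₀ and every set S ⊆ Γ × Γ with |S| ≥ c·|Γ|², there exists a subset T ⊆ Γ with |T| ≤ 8√k (a bound not depending on c) such that the number of pairs (a,b) ∈ S with a ∈ T, b ∈ T and a·b ∈ T is at least k. -/
/-- The number of pairs `(a,b) ∈ S` spanned by `T`, i.e. with `a ∈ T`, `b ∈ T`, `a * b ∈ T`. -/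
def spannedCount {Γ : Type} [Group Γ] [DecidableEq Γ] (S : Finset (Γ × Γ)) (T : Finset Γ) : ℕ :=
  (S.filter (fun p => p.1 ∈ T ∧ p.2 ∈ T ∧ p.1 * p.2 ∈ T)).card

/-- The average of a real function over a finite type. -/
noncomputable def avg {X : Type*} [Finite X] (f : X → ℝ) : ℝ :=
  (∑ᶠ x, f x) / Nat.card X

open Classical in
/-- The real-valued indicator of a proposition. -/
noncomputable def ind (p : Prop) : ℝ := if p then 1 else 0

@[simp] theorem ind_of_true {p : Prop} (h : p) : ind p = 1 := by simp [ind, h]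

@[simp] theorem ind_of_not {p : Prop} (h : ¬ p) : ind p = 0 := by simp [ind, h]

theorem ind_nonneg (p : Prop) : 0 ≤ ind p := by
  by_cases h : p <;> simp [h]

theorem ind_le_one (p : Prop) : ind p ≤ 1 := by
  by_cases h : p <;> simp [h]

theorem ind_mono {p q : Prop} (h : p → q) : ind p ≤ ind q := by
  by_cases hp : p
  · simp [hp, h hp]
  · simp [hp, ind_nonneg]

theorem ind_congr {p q : Prop} (h : p ↔ q) : ind p = ind q := by rw [propext h]

section Avg

variable {X Y : Type*} [Finite X] [Finite Y]

theorem avg_eq_sum [Fintype X] (f : X → ℝ) : avg f = (∑ x, f x) / Fintype.card X := by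
  rw [avg, finsum_eq_sum_of_fintype, Nat.card_eq_fintype_card]

theorem avg_const [Nonempty X] (c : ℝ) : avg (fun _ : X => c) = c := by
  have := Fintype.ofFinite X
  rw [avg_eq_sum]
  have : (Fintype.card X : ℝ) ≠ 0 := by exact_mod_cast Fintype.card_ne_zero
  simp [this]

theorem avg_mono {f g : X → ℝ} (h : ∀ x, f x ≤ g x) : avg f ≤ avg g := by
  have := Fintype.ofFinite X
  rw [avg_eq_sum, avg_eq_sum]
  gcongr with x
  exact h x

theorem avg_nonneg {f : X → ℝ} (h : ∀ x, 0 ≤ f x) : 0 ≤ avg f := by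
  have := Fintype.ofFinite X
  rw [avg_eq_sum]
  exact div_nonneg (Finset.sum_nonneg fun x _ => h x) (Nat.cast_nonneg _)

theorem avg_le_const [Nonempty X] {f : X → ℝ} {c : ℝ} (h : ∀ x, f x ≤ c) : avg f ≤ c :=
  (avg_mono h).trans (avg_const c).le

theorem const_le_avg [Nonempty X] {f : X → ℝ} {c : ℝ} (h : ∀ x, c ≤ f x) : c ≤ avg f :=
  (avg_const c).ge.trans (avg_mono h)

theorem exists_le_of_le_avg [Nonempty X] {f : X → ℝ} {c : ℝ} (h : c ≤ avg f) : ∃ x, c ≤ f x := by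
  have := Fintype.ofFinite X
  by_contra! hlt
  rw [avg_eq_sum, le_div_iff₀ (by exact_mod_cast Fintype.card_pos)] at h
  have : ∑ x, f x < ∑ _x : X, c := Finset.sum_lt_sum_of_nonempty Finset.univ_nonempty
    fun x _ => hlt x
  simp only [Finset.sum_const, Finset.card_univ, nsmul_eq_mul] at this
  linarith

theorem avg_add (f g : X → ℝ) : avg (fun x => f x + g x) = avg f + avg g := by
  have := Fintype.ofFinite X
  simp only [avg_eq_sum, Finset.sum_add_distrib, add_div]

theorem avg_sub (f g : X → ℝ) : avg (fun x => f x - g x) = avg f - avg g := by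
  have := Fintype.ofFinite X
  simp only [avg_eq_sum, Finset.sum_sub_distrib, sub_div]

theorem avg_const_mul (c : ℝ) (f : X → ℝ) : avg (fun x => c * f x) = c * avg f := by
  have := Fintype.ofFinite X
  simp only [avg_eq_sum, ← Finset.mul_sum, mul_div_assoc]

theorem avg_sum {W : Type*} [Fintype W] (f : W → X → ℝ) :
    avg (fun x => ∑ w, f w x) = ∑ w, avg (f w) := by
  have := Fintype.ofFinite X
  simp only [avg_eq_sum]
  rw [Finset.sum_comm, Finset.sum_div]

theorem avg_equiv (e : X ≃ Y) (f : Y → ℝ) : avg (fun x => f (e x)) = avg f := by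
  rw [avg, avg, Nat.card_congr e, finsum_comp_equiv e]

theorem avg_prod (f : X × Y → ℝ) : avg f = avg fun x => avg fun y => f (x, y) := by
  have := Fintype.ofFinite X
  have := Fintype.ofFinite Y
  simp only [avg_eq_sum, Fintype.sum_prod_type, Fintype.card_prod, ← Finset.sum_div, Nat.cast_mul]
  rw [div_div, mul_comm]

theorem avg_comm (f : X → Y → ℝ) :
    (avg fun x => avg fun y => f x y) = avg fun y => avg fun x => f x y := by
  rw [← avg_prod fun p : X × Y => f p.1 p.2, ← avg_prod fun p : Y × X => f p.2 p.1,
    ← avg_equiv (Equiv.prodComm X Y)]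
  rfl

/-- A function bounded by `1` whose average is at least `c` is at least `c / 2` on a set of density
at least `c / 2`. -/
theorem le_avg_ind_of_le_avg [Nonempty X] {f : X → ℝ} {c : ℝ} (hc : 0 ≤ c) (hf : ∀ x, f x ≤ 1)
    (h : c ≤ avg f) : c / 2 ≤ avg fun x => ind (c / 2 ≤ f x) := by
  have h1 : avg f ≤ avg fun x => ind (c / 2 ≤ f x) + c / 2 := by
    refine avg_mono fun x => ?_
    by_cases hx : c / 2 ≤ f x
    · simp only [ind_of_true hx]
      linarith [hf x]
    · simp only [ind_of_not hx]
      linarith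
  rw [avg_add, avg_const] at h1
  linarith

theorem avg_ind_injective (v : X → Y) (hv : Function.Injective v) (h : Y → ℝ) :
    (avg fun y => ind (y ∈ Set.range v) * h y) =
      (Nat.card X / Nat.card Y : ℝ) * avg fun x => h (v x) := by
  classical
  have := Fintype.ofFinite X
  have := Fintype.ofFinite Y
  rcases isEmpty_or_nonempty X with hX | hX
  · simp [avg_eq_sum]
  have h0 : (Nat.card X : ℝ) ≠ 0 := by exact_mod_cast Nat.card_pos.ne'
  have : (∑ y, ind (y ∈ Set.range v) * h y) = ∑ x, h (v x) := by
    rw [← Finset.sum_image (s := Finset.univ) (f := h) (g := v) hv.injOn, eq_comm]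
    refine Finset.sum_subset_zero_on_sdiff (Finset.subset_univ _) ?_ ?_
    · intro y hy
      rw [ind_of_not, zero_mul]
      simpa using hy
    · intro y hy
      rw [ind_of_true, one_mul]
      simpa using hy
  rw [avg_eq_sum, avg_eq_sum, this, ← Nat.card_eq_fintype_card, ← Nat.card_eq_fintype_card]
  field_simp

theorem avg_pi_prod {ι Q : Type*} [Fintype ι] [Finite Q] (h : Q → ℝ) :
    (avg fun q : ι → Q => ∏ i, h (q i)) = avg h ^ Fintype.card ι := by
  classical
  have := Fintype.ofFinite Q
  rw [avg_eq_sum, avg_eq_sum, div_pow]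
  congr 1
  · rw [← Finset.card_univ, ← Finset.prod_const, Finset.prod_univ_sum, Fintype.piFinset_univ]
  · simp

theorem avg_sum_arrow {ι κ α : Type*} [Finite ι] [Finite κ] [Finite α] (f : (ι ⊕ κ → α) → ℝ) :
    avg f = avg fun x : ι → α => avg fun y : κ → α => f (Sum.elim x y) := by
  rw [← avg_equiv (Equiv.sumArrowEquivProdArrow ι κ α).symm, avg_prod]
  rfl

theorem avg_restrict {ι α : Type*} [Finite ι] [Finite α] [Nonempty α] (F : Set ι)
    (g : (F → α) → ℝ) : (avg fun w : ι → α => g fun i => w i) = avg g := by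
  classical
  rw [← avg_equiv (Equiv.piEquivPiSubtypeProd (· ∈ F) fun _ => α).symm, avg_prod]
  congr 1
  ext u
  rw [← avg_const (X := {i // i ∉ F} → α) (g u)]
  congr 1
  ext w
  congr 1
  ext i
  simp

/-- If every fibre `A y` of density at least `c / 2` contains one of finitely many witnesses, then
one witness is contained in many fibres. -/
theorem exists_witness_of_le_avg [Nonempty X] [Nonempty Y] {W : Type*} [Finite W]
    (T : W → Set X) (A : Y → Set X) {c : ℝ} (hc : 0 < c)
    (hT : ∀ y, c / 2 ≤ avg (fun x => ind (x ∈ A y)) → ∃ w, T w ⊆ A y)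
    (hA : c ≤ avg fun y => avg fun x => ind (x ∈ A y)) :
    ∃ w, c / 2 / (Nat.card W + 1) ≤ avg fun y => ind (T w ⊆ A y) := by
  have := Fintype.ofFinite W
  have h1 := le_avg_ind_of_le_avg hc.le (fun y => avg_le_const fun x => ind_le_one _) hA
  have h2 : c / 2 ≤ ∑ w, avg fun y => ind (T w ⊆ A y) := by
    rw [← avg_sum]
    refine h1.trans (avg_mono fun y => ?_)
    by_cases hy : c / 2 ≤ avg (fun x => ind (x ∈ A y))
    · obtain ⟨w, hw⟩ := hT y hy
      rw [ind_of_true hy, ← ind_of_true hw]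
      exact Finset.single_le_sum (f := fun w => ind (T w ⊆ A y)) (fun w _ => ind_nonneg _)
        (Finset.mem_univ w)
    · rw [ind_of_not hy]
      exact Finset.sum_nonneg fun w _ => ind_nonneg _
  by_contra! hlt
  have h3 : ∑ w, avg (fun y => ind (T w ⊆ A y)) ≤ ∑ _w : W, c / 2 / (Nat.card W + 1) :=
    Finset.sum_le_sum fun w _ => (hlt w).le
  rw [Finset.sum_const, Finset.card_univ, nsmul_eq_mul, ← Nat.card_eq_fintype_card] at h3
  have h4 : (Nat.card W : ℝ) * (c / 2 / (Nat.card W + 1)) < c / 2 := by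
    rw [mul_div_assoc', div_lt_iff₀ (by positivity)]
    nlinarith
  linarith

end Avg

namespace Combinatorics

/-- Composition of combinatorial subspaces. -/
def Subspace.comp {η ζ α ι : Type*} (S : Subspace η α ι) (T : Subspace ζ α η) :
    Subspace ζ α ι where
  idxFun i := (S.idxFun i).elim Sum.inl T.idxFun
  proper e := by
    obtain ⟨j, hj⟩ := T.proper e
    obtain ⟨i, hi⟩ := S.proper j
    exact ⟨i, by simp [hi, hj]⟩

@[simp] theorem Subspace.comp_apply {η ζ α ι : Type*} (S : Subspace η α ι) (T : Subspace ζ α η)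
    (x : ζ → α) : S.comp T x = S (T x) := by
  funext i
  cases h : S.idxFun i <;> simp [Subspace.comp, Subspace.apply_def, h]

/-- The image of a combinatorial line under a combinatorial subspace. -/
def Subspace.mapLine {η α ι : Type*} (S : Subspace η α ι) (l : Line α η) : Line α ι where
  idxFun i := (S.idxFun i).elim some l.idxFun
  proper := by
    obtain ⟨j, hj⟩ := l.proper
    obtain ⟨i, hi⟩ := S.proper j
    exact ⟨i, by simp [hi, hj]⟩

@[simp] theorem Subspace.mapLine_apply {η α ι : Type*} (S : Subspace η α ι) (l : Line α η)
    (a : α) : S.mapLine l a = S (l a) := by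
  funext i
  cases h : S.idxFun i <;> simp [Subspace.mapLine, Subspace.apply_def, Line.apply_def, h]

/-- The subspace of all functions agreeing with `c` off `F`. -/
def Subspace.ofSet {α ι : Type*} (F : Set ι) [DecidablePred (· ∈ F)] (c : ι → α) :
    Subspace F α ι where
  idxFun i := if h : i ∈ F then Sum.inr ⟨i, h⟩ else Sum.inl (c i)
  proper e := ⟨e, by simp⟩

theorem Subspace.ofSet_apply {α ι : Type*} (F : Set ι) [DecidablePred (· ∈ F)] (c : ι → α)
    (u : F → α) (i : ι) :
    Subspace.ofSet F c u i = if h : i ∈ F then u ⟨i, h⟩ else c i := by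
  by_cases h : i ∈ F <;> simp [Subspace.apply_def, Subspace.ofSet, h]

/-- The subspace of all functions on a sum type with prescribed left component. -/
def Subspace.inr {α κ : Type*} (ι : Type*) (c : κ → α) : Subspace ι α (κ ⊕ ι) where
  idxFun := Sum.elim (fun k => Sum.inl (c k)) Sum.inr
  proper e := ⟨Sum.inr e, rfl⟩

@[simp] theorem Subspace.inr_apply {α κ ι : Type*} (c : κ → α) (x : ι → α) :
    Subspace.inr ι c x = Sum.elim c x := by
  funext i
  cases i <;> rfl

/-- The subspace of all functions on a sum type with prescribed right component. -/
def Subspace.inl {α κ : Type*} (ι : Type*) (c : κ → α) : Subspace ι α (ι ⊕ κ) where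
  idxFun := Sum.elim Sum.inr (fun k => Sum.inl (c k))
  proper e := ⟨Sum.inl e, rfl⟩

@[simp] theorem Subspace.inl_apply {α κ ι : Type*} (c : κ → α) (x : ι → α) :
    Subspace.inl ι c x = Sum.elim x c := by
  funext i
  cases i <;> rfl

/-- The subspace induced by a bijection of the coordinates. -/
def Subspace.ofEquiv {ι κ : Type*} (α : Type*) (e : ι ≃ κ) : Subspace κ α ι where
  idxFun i := Sum.inr (e i)
  proper k := ⟨e.symm k, by simp⟩

instance Subspace.instFinite {η α ι : Type*} [Finite η] [Finite α] [Finite ι] :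
    Finite (Subspace η α ι) :=
  Finite.of_injective (fun S => S.idxFun) fun _ _ h => Subspace.ext h

instance Line.instFinite {α ι : Type*} [Finite α] [Finite ι] : Finite (Line α ι) :=
  Finite.of_injective (fun l => l.idxFun) fun _ _ h => Line.ext h

theorem avg_ofEquiv {ι κ α : Type*} [Finite ι] [Finite κ] [Finite α] (e : ι ≃ κ)
    (f : (ι → α) → ℝ) : (avg fun x : κ → α => f (Subspace.ofEquiv α e x)) = avg f := by
  rw [← avg_equiv (Equiv.arrowCongr e.symm (Equiv.refl α))]
  rfl

end Combinatorics

open Combinatorics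

/-- A finite type with at least `m + n` elements is a sum of `Fin m` and a type with at least `n`
elements. -/
theorem exists_equiv_fin_sum {ι : Type} [Finite ι] {m n : ℕ} (h : m + n ≤ Nat.card ι) :
    ∃ κ : Type, ∃ _ : Finite κ, n ≤ Nat.card κ ∧ Nonempty (ι ≃ Fin m ⊕ κ) := by
  refine ⟨Fin (Nat.card ι - m), inferInstance, by simp; omega, ?_⟩
  refine Finite.card_eq.1 ?_
  · rw [Nat.card_sum, Nat.card_fin, Nat.card_fin]
    omega

/-- A random word contains a given letter many times. -/
theorem exists_avg_few_le {Q : Type} [Finite Q] (s : Q) (N : ℕ) {b : ℝ} (hb : 0 < b) :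
    ∃ M : ℕ, ∀ (ι : Type) [Finite ι], M ≤ Nat.card ι →
      (avg fun q : ι → Q => ind (Nat.card {i // q i = s} < N)) ≤ b := by
  classical
  have := Fintype.ofFinite Q
  have hcard : (1 : ℝ) ≤ Fintype.card Q := by
    exact_mod_cast Fintype.card_pos_iff.2 ⟨s⟩
  set h : Q → ℝ := fun t => if t = s then 1 / 2 else 1 with hdef
  have h_avg : avg h = 1 - 1 / (2 * Fintype.card Q) := by
    have h1 : h = fun t => 1 - (if t = s then 1 / 2 else 0) := by
      ext t
      by_cases ht : t = s <;> simp [hdef, ht]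
      norm_num
    rw [avg_eq_sum, h1, Finset.sum_sub_distrib]
    simp
    field_simp
  have h0 : 0 ≤ avg h := avg_nonneg fun t => by
    by_cases ht : t = s <;> simp [hdef, ht]
  have hlt : avg h < 1 := by
    rw [h_avg]
    have : 0 < 1 / (2 * (Fintype.card Q : ℝ)) := by positivity
    linarith
  obtain ⟨M, hM⟩ := exists_pow_lt_of_lt_one (show 0 < b / 2 ^ N by positivity) hlt
  refine ⟨M, fun ι _ hι => ?_⟩
  have := Fintype.ofFinite ι
  rw [Nat.card_eq_fintype_card] at hι
  calc (avg fun q : ι → Q => ind (Nat.card {i // q i = s} < N))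
      ≤ avg fun q : ι → Q => 2 ^ N * ∏ i, h (q i) := by
        refine avg_mono fun q => ?_
        have hprod : ∏ i, h (q i) = (1 / 2) ^ Nat.card {i // q i = s} := by
          simp only [hdef]
          rw [Finset.prod_ite, Finset.prod_const, Finset.prod_const_one, mul_one,
            Nat.card_eq_fintype_card, Fintype.card_subtype]
        rw [hprod]
        by_cases hq : Nat.card {i // q i = s} < N
        · rw [ind_of_true hq, one_div, inv_pow, ← div_eq_mul_inv, le_div_iff₀ (by positivity),
            one_mul]
          exact pow_le_pow_right₀ one_le_two hq.le
        · rw [ind_of_not hq]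
          positivity
    _ = 2 ^ N * avg h ^ Fintype.card ι := by rw [avg_const_mul, avg_pi_prod]
    _ ≤ 2 ^ N * avg h ^ M := by
        gcongr 2 ^ N * ?_
        exact pow_le_pow_of_le_one h0 hlt.le hι
    _ ≤ 2 ^ N * (b / 2 ^ N) := by gcongr
    _ = b := by field_simp

open Classical in
/-- The involution of `Q × γ` exchanging the second coordinate with the preimage of the first
one under `s`, when there is one. -/
noncomputable def swapLetter {Q γ : Type*} {s : γ → Q} (hs : Function.Injective s) :
    Q × γ ≃ Q × γ :=
  Function.Involutive.toPerm
    (fun p => if h : ∃ a, s a = p.1 then (s p.2, h.choose) else p) (by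
      rintro ⟨q, b⟩
      by_cases h : ∃ a, s a = q
      · have h2 : ∃ a, s a = s b := ⟨b, rfl⟩
        simp only [h, dite_true, h2, Prod.mk.injEq]
        exact ⟨h.choose_spec, hs h2.choose_spec⟩
      · simp only [h, dite_false])

open Classical in
theorem swapLetter_fst {Q γ : Type*} {s : γ → Q} (hs : Function.Injective s) (p : Q × γ) :
    (swapLetter hs p).1 = if p.1 ∈ Set.range s then s p.2 else p.1 := by
  change (if h : ∃ a, s a = p.1 then (s p.2, h.choose) else p).1 = _
  by_cases h : ∃ a, s a = p.1
  · simp only [h, dite_true, Set.mem_range, if_true]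
  · simp only [h, dite_false, Set.mem_range, if_false]

open Classical in
/-- Resampling a random word over `Q` at the positions of the letters in the image of `s`. -/
theorem avg_resample {Q γ ι : Type} [Finite Q] [Finite γ] [Nonempty γ] [Finite ι] {s : γ → Q}
    (hs : Function.Injective s) (g : (ι → Q) → ℝ) :
    avg g = avg fun q : ι → Q => avg fun w : ι → γ => g fun i =>
      if q i ∈ Set.range s then s (w i) else q i := by
  let e : (ι → Q) × (ι → γ) ≃ (ι → Q) × (ι → γ) :=
    (Equiv.arrowProdEquivProdArrow ι (fun _ => Q) (fun _ => γ)).symm.trans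
      ((Equiv.arrowCongr (Equiv.refl ι) (swapLetter hs)).trans
        (Equiv.arrowProdEquivProdArrow ι (fun _ => Q) (fun _ => γ)))
  have h1 : avg g = avg fun p : (ι → Q) × (ι → γ) => g p.1 := by
    rw [avg_prod]
    simp only [avg_const]
  rw [h1, ← avg_equiv e, avg_prod]
  congr 1
  ext q
  congr 1
  ext w
  congr 1
  ext i
  exact swapLetter_fst hs (q i, w i)

open Classical in
theorem exists_resample {Q γ : Type} [Finite Q] [Finite γ] [Nonempty γ] {s : γ → Q}
    (hs : Function.Injective s) (N : ℕ) {b : ℝ} (hb : 0 < b) :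
    ∃ M : ℕ, ∀ (ι : Type) [Finite ι], M ≤ Nat.card ι → ∀ (g : (ι → Q) → ℝ), (∀ q, g q ≤ 1) →
      ∀ c, b < c → c ≤ avg g → ∃ (q : ι → Q) (F : Set ι), N ≤ Nat.card F ∧
        c - b ≤ avg fun u : F → γ => g fun i => if h : i ∈ F then s (u ⟨i, h⟩) else q i := by
  obtain ⟨a⟩ := ‹Nonempty γ›
  obtain ⟨M, hM⟩ := exists_avg_few_le (s a) N hb
  have : Nonempty γ := ⟨a⟩
  have : Nonempty Q := ⟨s a⟩
  refine ⟨M, fun ι _ hι g hg c hbc hc => ?_⟩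
  rw [avg_resample hs g] at hc
  have h2 : c - b ≤ avg fun q : ι → Q => (avg fun w : ι → γ => g fun i =>
      if q i ∈ Set.range s then s (w i) else q i) - ind (Nat.card {i // q i = s a} < N) := by
    rw [avg_sub]
    linarith [hM ι hι]
  obtain ⟨q, hq⟩ := exists_le_of_le_avg h2
  have hfew : ¬ Nat.card {i // q i = s a} < N := by
    intro hlt
    rw [ind_of_true hlt] at hq
    have : (avg fun w : ι → γ => g fun i =>
      if q i ∈ Set.range s then s (w i) else q i) ≤ 1 := avg_le_const fun w => hg _
    linarith
  rw [ind_of_not hfew, sub_zero] at hq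
  refine ⟨q, {i | q i ∈ Set.range s}, ?_, ?_⟩
  · refine (not_lt.1 hfew).trans ?_
    exact Nat.card_le_card_of_injective
      (fun i : {i // q i = s a} => (⟨i.1, a, i.2.symm⟩ : {i | q i ∈ Set.range s}))
      fun i j hij => Subtype.ext (congrArg (fun z => z.1) hij)
  · rw [← avg_restrict {i | q i ∈ Set.range s}]
    exact hq

/-- Every dense set has a family of parallel sections over a subspace, all of whose point sections
are almost as dense as the set. -/
theorem exists_sections {β : Type} [Finite β] [Nonempty β] (m : ℕ) {ε : ℝ} (hε : 0 < ε) :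
    ∃ n : ℕ, ∀ (ι : Type) [Finite ι], n ≤ Nat.card ι → ∀ A : Set (ι → β),
      ∃ (Y : Type) (_ : Finite Y) (_ : Nonempty Y) (Θ : Y → Subspace (Fin m) β ι),
        ∀ x, avg (fun z => ind (z ∈ A)) - ε ≤ avg fun y => ind (Θ y x ∈ A) := by
  set ε' : ℝ := ε / Nat.card (Fin m → β) with hε'
  have hcard : (0 : ℝ) < Nat.card (Fin m → β) := by exact_mod_cast Nat.card_pos
  have hε'0 : 0 < ε' := by positivity
  have key : ∀ r : ℕ, ∃ n : ℕ, ∀ (ι : Type) [Finite ι], n ≤ Nat.card ι → ∀ A : Set (ι → β),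
      1 < avg (fun z => ind (z ∈ A)) + r * ε' →
      ∃ (Y : Type) (_ : Finite Y) (_ : Nonempty Y) (Θ : Y → Subspace (Fin m) β ι),
        ∀ x, avg (fun z => ind (z ∈ A)) - ε ≤ avg fun y => ind (Θ y x ∈ A) := by
    intro r
    induction r with
    | zero =>
      refine ⟨0, fun ι _ _ A hA => ?_⟩
      have : avg (fun z => ind (z ∈ A)) ≤ 1 := avg_le_const fun z => ind_le_one _
      simp at hA
      linarith
    | succ r ih =>
      obtain ⟨n, hn⟩ := ih
      refine ⟨m + n, fun ι _ hι A hA => ?_⟩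
      obtain ⟨κ, _, hκ, ⟨e⟩⟩ := exists_equiv_fin_sum hι
      set δ := avg fun z => ind (z ∈ A) with hδ
      let E : (Fin m → β) → Subspace κ β ι := fun x =>
        (Subspace.ofEquiv β e).comp (Subspace.inr κ x)
      let G : (κ → β) → Subspace (Fin m) β ι := fun y =>
        (Subspace.ofEquiv β e).comp (Subspace.inl (Fin m) y)
      have hEG : ∀ x y, G y x = E x y := fun x y => by simp [E, G]
      have hδ2 : δ = avg fun x : Fin m → β => avg fun y : κ → β => ind (E x y ∈ A) := by
        rw [hδ, ← avg_ofEquiv e, avg_sum_arrow]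
        simp [E]
      by_cases hall : ∀ x, δ - ε ≤ avg fun y : κ → β => ind (E x y ∈ A)
      · refine ⟨κ → β, inferInstance, inferInstance, G, fun x => ?_⟩
        simpa only [hEG] using hall x
      push Not at hall
      obtain ⟨x₀, hx₀⟩ := hall
      obtain ⟨x₁, hx₁⟩ : ∃ x₁, δ + ε' ≤ avg fun y : κ → β => ind (E x₁ y ∈ A) := by
        by_contra! hlt
        have hle : δ ≤ avg fun x : Fin m → β =>
            (δ + ε') - ε * ind (x = x₀) - ε' * ind (x = x₀) := by
          rw [hδ2]
          refine avg_mono fun x => ?_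
          rw [← hδ2]
          by_cases hx : x = x₀
          · subst hx
            simp only [ind_of_true]
            linarith
          · simp only [ind_of_not hx]
            linarith [hlt x]
        have hpoint : avg (fun x : Fin m → β => ind (x = x₀)) = 1 / Nat.card (Fin m → β) := by
          classical
          have := Fintype.ofFinite (Fin m → β)
          rw [avg_eq_sum, Nat.card_eq_fintype_card]
          rw [Finset.sum_eq_single x₀ (fun x _ hx => ind_of_not hx) (by simp), ind_of_true rfl]
        rw [avg_sub, avg_sub, avg_const, avg_const_mul, avg_const_mul, hpoint, mul_one_div,
          ← hε'] at hle
        have : 0 < ε' * (1 / Nat.card (Fin m → β)) := by positivity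
        linarith
      obtain ⟨Y, hY, hY', Θ, hΘ⟩ := hn κ hκ {y | E x₁ y ∈ A} (by
        simp only [Set.mem_ofPred_eq]
        push_cast at hA
        linarith)
      refine ⟨Y, hY, hY', fun y => (E x₁).comp (Θ y), fun x => ?_⟩
      have := hΘ x
      simp only [Set.mem_ofPred_eq] at this
      simp only [Subspace.comp_apply]
      linarith
  obtain ⟨r, hr⟩ := exists_nat_gt (1 / ε')
  obtain ⟨n, hn⟩ := key r
  refine ⟨n, fun ι _ hι A => hn ι hι A ?_⟩
  have h0 : 0 ≤ avg fun z => ind (z ∈ A) := avg_nonneg fun z => ind_nonneg _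
  rw [div_lt_iff₀ hε'0] at hr
  linarith

/-- The density Hales-Jewett property of a finite alphabet. -/
def DensityHalesJewett (α : Type) [Finite α] : Prop :=
  ∀ δ : ℝ, 0 < δ → ∃ N : ℕ, ∀ (ι : Type) [Finite ι], N ≤ Nat.card ι → ∀ A : Set (ι → α),
    δ ≤ avg (fun x => ind (x ∈ A)) → ∃ l : Line α ι, ∀ a, l a ∈ A

/-- The multidimensional form of the density Hales-Jewett property. -/
theorem DensityHalesJewett.exists_subspace {α : Type} [Finite α] [Nonempty α]
    (h : DensityHalesJewett α) (d : ℕ) : ∀ δ : ℝ, 0 < δ → ∃ N : ℕ, ∀ (ι : Type) [Finite ι],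
      N ≤ Nat.card ι → ∀ A : Set (ι → α), δ ≤ avg (fun x => ind (x ∈ A)) →
        ∃ S : Subspace (Fin d) α ι, ∀ x, S x ∈ A := by
  induction d with
  | zero =>
    refine fun δ hδ => ⟨0, fun ι _ _ A hA => ?_⟩
    obtain ⟨z, hz⟩ := exists_le_of_le_avg hA
    have hzA : z ∈ A := by
      by_contra hn
      rw [ind_of_not hn] at hz
      linarith
    exact ⟨⟨fun i => Sum.inl (z i), fun e => e.elim0⟩, fun _ => hzA⟩
  | succ d ih =>
    intro δ hδ
    obtain ⟨m, hm⟩ := h (δ / 2) (by positivity)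
    obtain ⟨n, hn⟩ := ih (δ / 2 / (Nat.card (Line α (Fin m)) + 1)) (by positivity)
    refine ⟨m + n, fun ι _ hι A hA => ?_⟩
    obtain ⟨κ, _, hκ, ⟨e⟩⟩ := exists_equiv_fin_sum hι
    let P : (Fin m → α) → (κ → α) → ι → α := fun x y => Subspace.ofEquiv α e (Sum.elim x y)
    rw [← avg_ofEquiv e, avg_sum_arrow, avg_comm] at hA
    obtain ⟨l, hl⟩ := exists_witness_of_le_avg (X := Fin m → α) (Y := κ → α)
      (fun l : Line α (Fin m) => Set.range l) (fun y => {x | P x y ∈ A}) hδ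
      (fun y hy => by
        obtain ⟨l, hl⟩ := hm (Fin m) (by simp) {x | P x y ∈ A} hy
        exact ⟨l, by rintro _ ⟨a, rfl⟩; exact hl a⟩) hA
    obtain ⟨S, hS⟩ := hn κ hκ {y | Set.range l ⊆ {x | P x y ∈ A}} hl
    refine ⟨(Subspace.ofEquiv α e).comp ⟨Sum.elim (fun i => (l.idxFun i).elim (Sum.inr 0) Sum.inl)
      (fun k => (S.idxFun k).elim Sum.inl fun j => Sum.inr j.succ), ?_⟩, fun x => ?_⟩
    · intro j
      refine Fin.cases ?_ (fun j => ?_) j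
      · obtain ⟨i, hi⟩ := l.proper
        exact ⟨Sum.inl i, by simp [hi]⟩
      · obtain ⟨i, hi⟩ := S.proper j
        exact ⟨Sum.inr i, by simp [hi]⟩
    · have := hS (fun j => x j.succ) (Set.mem_range_self (x 0))
      change Subspace.ofEquiv α e (Sum.elim (l (x 0)) (S fun j => x j.succ)) ∈ A at this
      rw [Subspace.comp_apply]
      convert! this using 2
      funext i
      cases i with
      | inl i => cases hi : l.idxFun i <;> simp [Subspace.apply_def, hi]
      | inr i => cases hi : S.idxFun i <;> simp [Subspace.apply_def, hi]

/-- Replace every wildcard by the letter `a`. -/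
def collapse {α ι : Type*} (a : α) (x : ι → Option α) (i : ι) : Option α :=
  some ((x i).getD a)

/-- A set of words is `a`-insensitive if membership does not change when wildcards are replaced
by `a`. -/
def Insensitive {α ι : Type*} (a : α) (D : Set (ι → Option α)) : Prop :=
  ∀ x, collapse a x ∈ D ↔ x ∈ D

theorem collapse_subspace {α ι η : Type*} (a : α) (S : Subspace η (Option α) ι)
    (x : η → Option α) : collapse a (S (collapse a x)) = collapse a (S x) := by
  funext i
  cases h : S.idxFun i <;> simp [collapse, Subspace.apply_def, h]

theorem collapse_collapse {α ι : Type*} (a : α) (x : ι → Option α) :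
    collapse a (collapse a x) = collapse a x := by
  funext i
  simp [collapse]

theorem Insensitive.preimage {α ι η : Type*} {a : α} {D : Set (ι → Option α)}
    (h : Insensitive a D) (S : Subspace η (Option α) ι) : Insensitive a {x | S x ∈ D} := by
  intro x
  change S (collapse a x) ∈ D ↔ S x ∈ D
  rw [← h, collapse_subspace, h]

theorem Insensitive.compl {α ι : Type*} {a : α} {D : Set (ι → Option α)}
    (h : Insensitive a D) : Insensitive a {x | x ∉ D} := fun x => not_congr (h x)

theorem insensitive_collapse_mem {α ι : Type*} (a : α) (D : Set (ι → Option α)) :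
    Insensitive a {x | collapse a x ∈ D} := by
  intro x
  change collapse a (collapse a x) ∈ D ↔ _
  rw [collapse_collapse]
  rfl

/-- Extend a subspace over `α` to a subspace over `Option α`. -/
def Combinatorics.Subspace.toOption {η α ι : Type*} (S : Subspace η α ι) :
    Subspace η (Option α) ι where
  idxFun i := (S.idxFun i).map some id
  proper e := by
    obtain ⟨i, hi⟩ := S.proper e
    exact ⟨i, by simp [hi]⟩

theorem collapse_toOption {η α ι : Type*} (a : α) (S : Subspace η α ι) (x : η → Option α) :
    collapse a (S.toOption x) = fun i => some (S (fun j => (x j).getD a) i) := by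
  funext i
  cases h : S.idxFun i <;> simp [collapse, Subspace.toOption, Subspace.apply_def, h]

/-- Dense insensitive sets contain subspaces. -/
theorem exists_subspace_of_insensitive {α : Type} [Finite α] [Nonempty α]
    (h : DensityHalesJewett α) (d : ℕ) {β : ℝ} (hβ : 0 < β) : ∃ M : ℕ, ∀ (ι : Type) [Finite ι],
      M ≤ Nat.card ι → ∀ (a : α) (D : Set (ι → Option α)), Insensitive a D →
        β ≤ avg (fun x => ind (x ∈ D)) → ∃ S : Subspace (Fin d) (Option α) ι, ∀ x, S x ∈ D := by
  classical
  obtain ⟨N, hN⟩ := h.exists_subspace d (β / 2) (by positivity)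
  obtain ⟨M, hM⟩ := exists_resample (Option.some_injective α) N (b := β / 2) (by positivity)
  refine ⟨M, fun ι _ hι a D hD hβD => ?_⟩
  obtain ⟨q, F, hF, hq⟩ := hM ι hι _ (fun x => ind_le_one _) β (by linarith) hβD
  obtain ⟨T, hT⟩ := hN F hF {u | (fun i => if h : i ∈ F then some (u ⟨i, h⟩) else q i) ∈ D}
    (by rw [sub_half] at hq; exact hq)
  refine ⟨(Subspace.ofSet F q).comp T.toOption, fun x => ?_⟩
  rw [Subspace.comp_apply, ← hD, ← collapse_subspace, collapse_toOption]
  rw [hD]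
  have := hT fun j => (x j).getD a
  change (fun i => if h : i ∈ F then some (T (fun j => (x j).getD a) ⟨i, h⟩) else q i) ∈ D at this
  convert! this using 1
  funext i
  rw [Subspace.ofSet_apply]

/-- Greedy bound: if `f` has small average on all subspaces inside the insensitive set `D`, then
its integral over `D` is small. -/
theorem avg_insensitive_le {α : Type} [Finite α] [Nonempty α]
    (h : DensityHalesJewett α) (d : ℕ) {β : ℝ} (hβ : 0 < β) {κ : ℝ} (hκ : 0 ≤ κ) :
    ∃ (M : ℕ) (η : ℝ), 0 < η ∧ η ≤ 1 ∧ ∀ (J : ℕ) (ι : Type) [Finite ι], J * M ≤ Nat.card ι →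
      ∀ (a : α) (D : Set (ι → Option α)), Insensitive a D → ∀ f : (ι → Option α) → ℝ,
        (∀ x, f x ≤ 1) →
        (∀ S : Subspace (Fin d) (Option α) ι, (∀ x, S x ∈ D) → avg (fun x => f (S x)) ≤ κ) →
        avg (fun x => ind (x ∈ D) * f x) ≤
          κ * avg (fun x => ind (x ∈ D)) + β + (1 - η) ^ J * avg (fun x => ind (x ∈ D)) := by
  classical
  obtain ⟨M, hM⟩ := exists_subspace_of_insensitive h d (β := β / 2) (by positivity)
  set ρ : ℝ := Nat.card (Fin d → Option α) / Nat.card (Fin M → Option α) with hρ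
  set θ : ℝ := β / 2 / (Nat.card (Subspace (Fin d) (Option α) (Fin M)) + 1) with hθ
  have hc1 : (0 : ℝ) < Nat.card (Fin d → Option α) := by exact_mod_cast Nat.card_pos
  have hc2 : (0 : ℝ) < Nat.card (Fin M → Option α) := by exact_mod_cast Nat.card_pos
  have hρ0 : 0 < ρ := by positivity
  have hθ0 : 0 < θ := by positivity
  have hη0 : 0 < min 1 (ρ * θ) := lt_min one_pos (by positivity)
  have hη1 : min 1 (ρ * θ) ≤ 1 := min_le_left _ _
  have hη2 : min 1 (ρ * θ) ≤ ρ * θ := min_le_right _ _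
  set η : ℝ := min 1 (ρ * θ)
  refine ⟨M, η, hη0, hη1, fun J => ?_⟩
  induction J with
  | zero =>
    intro ι _ _ a D _ f hf _
    have h1 : avg (fun x => ind (x ∈ D) * f x) ≤ avg (fun x => ind (x ∈ D)) := by
      refine avg_mono fun x => ?_
      nlinarith [hf x, ind_nonneg (x ∈ D)]
    have h2 : 0 ≤ avg (fun x => ind (x ∈ D)) := avg_nonneg fun x => ind_nonneg _
    have := mul_nonneg hκ h2
    rw [pow_zero, one_mul]
    linarith
  | succ J ih =>
    intro ι _ hι a D hD f hf hS
    have hD0 : 0 ≤ avg (fun x => ind (x ∈ D)) := avg_nonneg fun x => ind_nonneg _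
    have hpow : 0 ≤ (1 - η) ^ J := pow_nonneg (by linarith) J
    have hDf : avg (fun x => ind (x ∈ D) * f x) ≤ avg (fun x => ind (x ∈ D)) := by
      refine avg_mono fun x => ?_
      nlinarith [hf x, ind_nonneg (x ∈ D)]
    rcases lt_or_ge (avg fun x => ind (x ∈ D)) β with hlt | hge
    · have := mul_nonneg hκ hD0
      have : 0 ≤ (1 - η) ^ (J + 1) * avg (fun x => ind (x ∈ D)) :=
        mul_nonneg (pow_nonneg (by linarith) _) hD0
      linarith
    obtain ⟨μ, _, hμ, ⟨e⟩⟩ := exists_equiv_fin_sum (m := M) (n := J * M) (ι := ι)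
      (by rw [add_mul] at hι; omega)
    let E : (Fin M → Option α) → Subspace μ (Option α) ι := fun x =>
      (Subspace.ofEquiv _ e).comp (Subspace.inr μ x)
    let G : (μ → Option α) → Subspace (Fin M) (Option α) ι := fun y =>
      (Subspace.ofEquiv _ e).comp (Subspace.inl (Fin M) y)
    have hEG : ∀ x y, G y x = E x y := fun x y => by simp [E, G]
    have hE : ∀ g : (ι → Option α) → ℝ, avg g = avg fun x => avg fun y => g (E x y) := by
      intro g
      rw [← avg_ofEquiv e, avg_sum_arrow]
      simp [E]
    obtain ⟨V, hV⟩ := exists_witness_of_le_avg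
      (fun V : Subspace (Fin d) (Option α) (Fin M) => Set.range V)
      (fun y => {x | E x y ∈ D}) hβ (fun y hy => by
        obtain ⟨V, hV⟩ := hM (Fin M) (by simp) a {x | E x y ∈ D}
          (by simpa only [hEG] using hD.preimage (G y)) hy
        exact ⟨V, by rintro _ ⟨x, rfl⟩; exact hV x⟩) (by
        rw [hE, avg_comm] at hge
        exact hge)
    set Y : Set (μ → Option α) := {y | ∀ z, E (V z) y ∈ D} with hY
    have hVY : θ ≤ avg fun y => ind (y ∈ Y) := by
      refine hV.trans (avg_mono fun y => ind_mono fun hy z => hy ⟨z, rfl⟩)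
    have hVinj : Function.Injective V := by
      intro z z' hzz
      funext j
      obtain ⟨i, hi⟩ := V.proper j
      have := congrFun hzz i
      rwa [Subspace.apply_inr hi, Subspace.apply_inr hi] at this
    have hYins : Insensitive a Y := by
      intro y
      exact forall_congr' fun z => hD.preimage (E (V z)) y
    let R : Set (Fin M → Option α) := Set.range V
    let D' : (Fin M → Option α) → Set (μ → Option α) := fun x =>
      {y | E x y ∈ D ∧ ¬ (x ∈ R ∧ y ∈ Y)}
    have hD'ins : ∀ x, Insensitive a (D' x) := by
      intro x y
      exact and_congr (hD.preimage (E x) y) (not_congr (and_congr Iff.rfl (hYins y)))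
    have hsplit : ∀ x y, ind (E x y ∈ D) = ind (x ∈ R) * ind (y ∈ Y) + ind (y ∈ D' x) := by
      intro x y
      by_cases hx : x ∈ R
      · by_cases hy : y ∈ Y
        · have h1 : E x y ∈ D := by
            obtain ⟨z, rfl⟩ := hx
            exact hy z
          have h2 : y ∉ D' x := fun h => h.2 ⟨hx, hy⟩
          simp [hx, hy, h1, h2]
        · have : y ∈ D' x ↔ E x y ∈ D := and_iff_left fun h => hy h.2
          simp [hy, ind_congr this]
      · have : y ∈ D' x ↔ E x y ∈ D := and_iff_left fun h => hx h.1
        simp [hx, ind_congr this]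
    set r := avg fun x => avg fun y => ind (y ∈ D' x) with hr
    have hcount : avg (fun x => ind (x ∈ D)) = ρ * avg (fun y => ind (y ∈ Y)) + r := by
      rw [hE]
      simp only [hsplit, avg_add, avg_const_mul]
      congr 1
      have := avg_ind_injective V hVinj fun _ => avg fun y => ind (y ∈ Y)
      rw [avg_const] at this
      exact this
    have hR : avg (fun x => avg fun y => ind (x ∈ R) * ind (y ∈ Y) * f (E x y)) ≤
        κ * (ρ * avg (fun y => ind (y ∈ Y))) := by
      simp only [mul_assoc, avg_const_mul]
      have := avg_ind_injective V hVinj fun x => avg fun y => ind (y ∈ Y) * f (E x y)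
      refine this.le.trans ?_
      rw [avg_comm, mul_left_comm κ]
      refine mul_le_mul_of_nonneg_left ?_ hρ0.le
      rw [← avg_const_mul]
      refine avg_mono fun y => ?_
      rw [avg_const_mul, mul_comm κ]
      by_cases hy : y ∈ Y
      · refine mul_le_mul_of_nonneg_left ?_ (ind_nonneg _)
        have := hS ((G y).comp V) (fun z => by
          rw [Subspace.comp_apply, hEG]
          exact hy z)
        simpa only [Subspace.comp_apply, hEG] using this
      · simp [hy]
    have hrest : ∀ x, avg (fun y => ind (y ∈ D' x) * f (E x y)) ≤
        κ * avg (fun y => ind (y ∈ D' x)) + β + (1 - η) ^ J * avg (fun y => ind (y ∈ D' x)) := by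
      intro x
      refine ih μ hμ a (D' x) (hD'ins x) (fun y => f (E x y)) (fun y => hf _) fun S hSD => ?_
      have := hS ((E x).comp S) fun z => by
        rw [Subspace.comp_apply]
        exact (hSD z).1
      simpa only [Subspace.comp_apply] using this
    have hrest' : avg (fun x => avg fun y => ind (y ∈ D' x) * f (E x y)) ≤
        κ * r + β + (1 - η) ^ J * r := by
      refine (avg_mono hrest).trans ?_
      rw [avg_add, avg_add, avg_const_mul, avg_const_mul, avg_const]
    have htotal : avg (fun x => ind (x ∈ D) * f x) =
        avg (fun x => avg fun y => ind (x ∈ R) * ind (y ∈ Y) * f (E x y)) +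
          avg (fun x => avg fun y => ind (y ∈ D' x) * f (E x y)) := by
      rw [hE, ← avg_add]
      simp only [hsplit, add_mul, avg_add]
    have hD1 : avg (fun x => ind (x ∈ D)) ≤ 1 := avg_le_const fun x => ind_le_one _
    have hrle : r ≤ (1 - η) * avg (fun x => ind (x ∈ D)) := by
      have h1 : η * avg (fun x => ind (x ∈ D)) ≤ ρ * avg fun y => ind (y ∈ Y) :=
        calc η * avg (fun x => ind (x ∈ D)) ≤ η := mul_le_of_le_one_right hη0.le hD1
          _ ≤ ρ * θ := hη2
          _ ≤ _ := mul_le_mul_of_nonneg_left hVY hρ0.le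
      linarith
    have hpr := mul_le_mul_of_nonneg_left hrle hpow
    rw [← mul_assoc, ← pow_succ] at hpr
    have : κ * avg (fun x => ind (x ∈ D)) = κ * (ρ * avg fun y => ind (y ∈ Y)) + κ * r := by
      rw [hcount]
      ring
    rw [htotal]
    linarith

/-- A function correlating with an insensitive set has a large average on a subspace inside it. -/
theorem exists_subspace_avg_ge {α : Type} [Finite α] [Nonempty α]
    (h : DensityHalesJewett α) (d : ℕ) {κ : ℝ} (hκ : 0 < κ) : ∃ M : ℕ, ∀ (ι : Type) [Finite ι],
      M ≤ Nat.card ι → ∀ (a : α) (D : Set (ι → Option α)), Insensitive a D →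
        ∀ f : (ι → Option α) → ℝ, (∀ x, f x ≤ 1) → κ ≤ avg (fun x => ind (x ∈ D) * f x) →
          ∃ S : Subspace (Fin d) (Option α) ι, (∀ x, S x ∈ D) ∧ κ / 2 ≤ avg fun x => f (S x) := by
  obtain ⟨M, η, hη0, hη1, hM⟩ := avg_insensitive_le h d (β := κ / 8) (by positivity)
    (κ := κ / 2) (by positivity)
  obtain ⟨J, hJ⟩ := exists_pow_lt_of_lt_one (show 0 < κ / 8 by positivity)
    (show 1 - η < 1 by linarith)
  refine ⟨J * M, fun ι _ hι a D hD f hf hfD => ?_⟩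
  by_contra! hno
  have := hM J ι hι a D hD f hf fun S hS => (hno S hS).le
  have h0 : 0 ≤ avg (fun x => ind (x ∈ D)) := avg_nonneg fun x => ind_nonneg _
  have h1 : avg (fun x => ind (x ∈ D)) ≤ 1 := avg_le_const fun x => ind_le_one _
  have h2 : 0 ≤ (1 - η) ^ J := pow_nonneg (by linarith) J
  nlinarith

/-- A function correlating with a union of complements of insensitive sets has a positive average
on some subspace. -/
theorem exists_subspace_avg_pos {α : Type} [Finite α] [Nonempty α]
    (h : DensityHalesJewett α) (d : ℕ) (s : Finset α) :
    ∀ κ : ℝ, 0 < κ → ∃ M : ℕ, ∀ (ι : Type) [Finite ι], M ≤ Nat.card ι →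
      ∀ D : α → Set (ι → Option α), (∀ a, Insensitive a (D a)) →
        ∀ f : (ι → Option α) → ℝ, (∀ x, f x ≤ 1) →
          κ ≤ avg (fun x => ind (∃ a ∈ s, x ∉ D a) * f x) →
            ∃ S : Subspace (Fin d) (Option α) ι, 0 < avg fun x => f (S x) := by
  classical
  induction s using Finset.induction with
  | empty =>
    refine fun κ hκ => ⟨0, fun ι _ _ D _ f _ hfD => ?_⟩
    have h0 : avg (fun x => ind (∃ a ∈ (∅ : Finset α), x ∉ D a) * f x) ≤ 0 :=
      avg_le_const fun x => by simp
    linarith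
  | insert a s _ ih =>
    intro κ hκ
    obtain ⟨M₀, hM₀⟩ := ih (κ / 4) (by positivity)
    obtain ⟨M₁, hM₁⟩ := exists_subspace_avg_ge h d (κ := κ / 2) (by positivity)
    obtain ⟨M₂, hM₂⟩ := exists_subspace_avg_ge h M₀ (κ := κ / 2) (by positivity)
    refine ⟨max M₁ M₂, fun ι _ hι D hD f hf hfD => ?_⟩
    have hsplit : ∀ x, ind (∃ b ∈ insert a s, x ∉ D b) * f x = ind (x ∉ D a) * f x +
        ind (x ∈ D a) * (ind (∃ b ∈ s, x ∉ D b) * f x) := by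
      intro x
      simp only [Finset.exists_mem_insert]
      by_cases hx : x ∈ D a <;> simp [hx]
    simp only [hsplit, avg_add] at hfD
    rcases le_or_gt (κ / 2) (avg fun x => ind (x ∉ D a) * f x) with h1 | h1
    · obtain ⟨S, _, hS⟩ := hM₁ ι ((le_max_left _ _).trans hι) a _ (hD a).compl f hf h1
      exact ⟨S, by linarith⟩
    · obtain ⟨S, hSD, hS⟩ := hM₂ ι ((le_max_right _ _).trans hι) a _ (hD a)
        (fun x => ind (∃ b ∈ s, x ∉ D b) * f x)
        (fun x => by
          have h0 := ind_nonneg (∃ b ∈ s, x ∉ D b)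
          have h1 := ind_le_one (∃ b ∈ s, x ∉ D b)
          nlinarith [hf x]) (by linarith)
      obtain ⟨T, hT⟩ := hM₀ (Fin M₀) (by simp) (fun b => {x | S x ∈ D b})
        (fun b => (hD b).preimage S) (fun x => f (S x)) (fun x => hf _) (by
          have e : κ / 2 / 2 = κ / 4 := by ring
          rw [e] at hS
          exact hS)
      exact ⟨S.comp T, by simpa only [Subspace.comp_apply] using hT⟩

/-- A word with a wildcard in `A` all of whose collapses are in `A` gives a line in `A`. -/
theorem exists_line_of_collapse {α ι : Type*} {A : Set (ι → Option α)} {x : ι → Option α}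
    (hx : x ∈ A) {i : ι} (hi : x i = none) (h : ∀ a, collapse a x ∈ A) :
    ∃ l : Line (Option α) ι, ∀ a, l a ∈ A := by
  refine ⟨⟨fun i => (x i).map some, i, by simp [hi]⟩, fun a => ?_⟩
  cases a with
  | none =>
    convert! hx using 1
    funext j
    cases hj : x j <;> simp [hj]
  | some a =>
    convert! h a using 1
    funext j
    cases hj : x j <;> simp [collapse, hj]

theorem collapse_elim_line {α η ι : Type*} (l : Line α η) (a : α) (q : ι → η ⊕ α) :
    collapse a (fun i => Sum.elim l.idxFun some (q i)) =
      fun i => Sum.elim (fun j => some (l a j)) some (q i) := by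
  funext i
  cases h : q i <;> simp [collapse, h]

/-- A dense set over `Option α` without lines has a density increment on a subspace. -/
theorem exists_subspace_increment {α : Type} [Finite α] [Nonempty α]
    (h : DensityHalesJewett α) {δ₀ : ℝ} (h₀ : 0 < δ₀) (h₁ : δ₀ ≤ 1) :
    ∃ γ : ℝ, 0 < γ ∧ ∀ d : ℕ, ∃ n : ℕ, ∀ (ι : Type) [Finite ι], n ≤ Nat.card ι →
      ∀ A : Set (ι → Option α), δ₀ ≤ avg (fun x => ind (x ∈ A)) →
        (∃ l : Line (Option α) ι, ∀ a, l a ∈ A) ∨ ∃ S : Subspace (Fin d) (Option α) ι,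
          avg (fun x => ind (x ∈ A)) + γ ≤ avg fun x => ind (S x ∈ A) := by
  classical
  have := Fintype.ofFinite α
  obtain ⟨m₀, hm₀⟩ := h (δ₀ / 2 / 2) (by positivity)
  set θ : ℝ := δ₀ / 2 / 2 / (Nat.card (Line α (Fin m₀)) + 1) with hθ
  have hθ0 : 0 < θ := by positivity
  have hθ1 : θ ≤ 1 := by
    rw [hθ, div_le_one (by positivity)]
    have : (0 : ℝ) ≤ Nat.card (Line α (Fin m₀)) := Nat.cast_nonneg _
    linarith
  set τ : ℝ := δ₀ * θ / 8 with hτ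
  have hτ0 : 0 < τ := by positivity
  have hτδ : τ ≤ δ₀ / 2 := by
    have := mul_le_of_le_one_right h₀.le hθ1
    linarith
  refine ⟨τ, hτ0, fun d => ?_⟩
  obtain ⟨N, hN⟩ := exists_subspace_avg_pos h d Finset.univ (4 * τ) (by positivity)
  choose slot hslot using fun l : Line α (Fin m₀) => l.proper
  let s : Line α (Fin m₀) → Option α → Fin m₀ ⊕ α := fun l o => o.elim (Sum.inl (slot l)) Sum.inr
  have hs : ∀ l, Function.Injective (s l) := by
    intro l o o'
    cases o <;> cases o' <;> simp [s]
  have hzs : ∀ l o, Sum.elim l.idxFun some (s l o) = o := by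
    intro l o
    cases o <;> simp [s, hslot]
  choose M₁ hM₁ using fun l => exists_resample (hs l) N hτ0
  choose M₂ hM₂ using fun l => exists_avg_few_le (s l none) 1 hτ0
  obtain ⟨m, hm⟩ : ∃ m, ∀ l, max (M₁ l) (M₂ l) ≤ m := by
    obtain ⟨m, hm⟩ := Set.finite_range (fun l => max (M₁ l) (M₂ l)) |>.bddAbove
    exact ⟨m, fun l => hm ⟨l, rfl⟩⟩
  obtain ⟨n, hn⟩ := exists_sections (β := Option α) m hτ0
  refine ⟨n, fun ι _ hι A hA => ?_⟩
  by_cases hline : ∃ l : Line (Option α) ι, ∀ a, l a ∈ A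
  · exact Or.inl hline
  refine Or.inr ?_
  set δ := avg (fun x => ind (x ∈ A)) with hδ
  obtain ⟨Y, _, _, Θ, hΘ⟩ := hn ι hι A
  let q₀ : (Fin m₀ → α) → (Fin m → Fin m₀ ⊕ α) → Fin m → Option α := fun u q i =>
    Sum.elim (fun j => some (u j)) some (q i)
  obtain ⟨l, hl⟩ := exists_witness_of_le_avg (X := Fin m₀ → α) (Y := Y × (Fin m → Fin m₀ ⊕ α))
    (fun l : Line α (Fin m₀) => Set.range l) (fun p => {u | Θ p.1 (q₀ u p.2) ∈ A})
    (c := δ₀ / 2) (by positivity) (fun p hp => by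
      obtain ⟨l, hl⟩ := hm₀ (Fin m₀) (by simp) _ hp
      exact ⟨l, by rintro _ ⟨a, rfl⟩; exact hl a⟩) (by
      rw [avg_comm]
      refine const_le_avg fun u => ?_
      rw [avg_prod, avg_comm]
      refine const_le_avg fun q => ?_
      have := hΘ (q₀ u q)
      change δ₀ / 2 ≤ avg fun y => ind (Θ y (q₀ u q) ∈ A)
      linarith)
  rw [avg_prod] at hl
  let z : (Fin m → Fin m₀ ⊕ α) → Fin m → Option α := fun q i => Sum.elim l.idxFun some (q i)
  let D : Y → α → Set (Fin m → Option α) := fun y a => {x | collapse a x ∈ {x | Θ y x ∈ A}}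
  let f : Y → (Fin m → Option α) → ℝ := fun y x => ind (Θ y x ∈ A) - (δ + τ)
  have hf1 : ∀ y x, f y x ≤ 1 := fun y x => by
    have := ind_le_one (Θ y x ∈ A)
    simp only [f]
    linarith
  have hpt : ∀ y q, ind (Θ y (z q) ∈ A) - ind (Nat.card {i // q i = s l none} < 1) - (δ + τ) +
      (δ + τ) * ind (Set.range l ⊆ {u | Θ y (q₀ u q) ∈ A}) ≤
        ind (∃ a ∈ Finset.univ, z q ∉ D y a) * f y (z q) := by
    intro y q
    have hr : Set.range l ⊆ {u | Θ y (q₀ u q) ∈ A} ↔ ¬ ∃ a ∈ Finset.univ, z q ∉ D y a := by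
      simp only [Finset.mem_univ, true_and, not_exists, not_not, Set.range_subset_iff]
      refine forall_congr' fun a => ?_
      change _ ↔ Θ y (collapse a (z q)) ∈ A
      rw [collapse_elim_line]
      rfl
    by_cases hE : ∃ a ∈ Finset.univ, z q ∉ D y a
    · have h2 : ¬ Set.range l ⊆ {u | Θ y (q₀ u q) ∈ A} := fun h => hr.1 h hE
      rw [ind_of_true hE, ind_of_not h2]
      have := ind_nonneg (Nat.card {i // q i = s l none} < 1)
      simp only [f]
      linarith
    · have h2 : Set.range l ⊆ {u | Θ y (q₀ u q) ∈ A} := hr.2 hE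
      rw [ind_of_not hE, ind_of_true h2]
      have : ind (Θ y (z q) ∈ A) ≤ ind (Nat.card {i // q i = s l none} < 1) := by
        refine ind_mono fun hA => ?_
        by_contra hfew
        rw [not_lt, Nat.one_le_iff_ne_zero, Nat.card_ne_zero] at hfew
        obtain ⟨⟨i, hi⟩⟩ := hfew.1
        obtain ⟨L, hL⟩ := exists_line_of_collapse (A := {x | Θ y x ∈ A}) hA (i := i)
          (by simp only [z, hi, hzs]) (fun a => by
            by_contra ha
            exact hE ⟨a, Finset.mem_univ a, ha⟩)
        exact hline ⟨(Θ y).mapLine L, fun a => by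
          rw [Subspace.mapLine_apply]
          exact hL a⟩
      linarith
  have hfew := hM₂ l (Fin m) (by simpa using (le_max_right _ _).trans (hm l))
  have havg : 5 * τ ≤ avg fun y => avg fun q =>
      ind (∃ a ∈ Finset.univ, z q ∉ D y a) * f y (z q) := by
    refine le_trans ?_ (avg_mono fun y => avg_mono fun q => hpt y q)
    simp only [avg_add, avg_sub, avg_const_mul, avg_const]
    have h1 : δ - τ ≤ avg fun y => avg fun q => ind (Θ y (z q) ∈ A) := by
      rw [avg_comm]
      exact const_le_avg fun q => hΘ (z q)
    have h2 : (δ + τ) * θ ≤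
        (δ + τ) * avg fun y => avg fun q => ind (Set.range l ⊆ {u | Θ y (q₀ u q) ∈ A}) :=
      mul_le_mul_of_nonneg_left hl (by linarith)
    have h3 : δ₀ * θ ≤ (δ + τ) * θ := mul_le_mul_of_nonneg_right (by linarith) hθ0.le
    linarith
  obtain ⟨y, hy⟩ := exists_le_of_le_avg havg
  obtain ⟨q, F, hF, hq⟩ := hM₁ l (Fin m) (by simpa using (le_max_left _ _).trans (hm l)) _
    (fun q => by
      have h0 := ind_nonneg (∃ a ∈ Finset.univ, z q ∉ D y a)
      have h1 := ind_le_one (∃ a ∈ Finset.univ, z q ∉ D y a)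
      nlinarith [hf1 y (z q)]) (5 * τ) (by linarith) hy
  let V := Subspace.ofSet F (z q)
  have hV : ∀ u : F → Option α,
      z (fun i => if h : i ∈ F then s l (u ⟨i, h⟩) else q i) = V u := by
    intro u
    funext i
    rw [Subspace.ofSet_apply]
    by_cases h : i ∈ F <;> simp [z, h, hzs]
  simp only [hV] at hq
  obtain ⟨S, hS⟩ := hN F hF (fun a => {u | V u ∈ D y a})
    (fun a => (insensitive_collapse_mem a _).preimage V) (fun u => f y (V u)) (fun u => hf1 y _)
    (by
      have e : 5 * τ - τ = 4 * τ := by ring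
      rw [e] at hq
      exact hq)
  refine ⟨(Θ y).comp (V.comp S), ?_⟩
  simp only [f, avg_sub, avg_const] at hS
  simp only [Subspace.comp_apply]
  linarith

theorem DensityHalesJewett.option {α : Type} [Finite α] [Nonempty α]
    (h : DensityHalesJewett α) : DensityHalesJewett (Option α) := by
  intro δ₀ h₀
  obtain ⟨γ, hγ, hinc⟩ := exists_subspace_increment h (lt_min h₀ one_pos) (min_le_right δ₀ 1)
  have key : ∀ r : ℕ, ∃ n : ℕ, ∀ (ι : Type) [Finite ι], n ≤ Nat.card ι →
      ∀ A : Set (ι → Option α), min δ₀ 1 ≤ avg (fun x => ind (x ∈ A)) →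
        1 < avg (fun x => ind (x ∈ A)) + r * γ → ∃ l : Line (Option α) ι, ∀ a, l a ∈ A := by
    intro r
    induction r with
    | zero =>
      refine ⟨0, fun ι _ _ A _ hA => ?_⟩
      have : avg (fun x => ind (x ∈ A)) ≤ 1 := avg_le_const fun x => ind_le_one _
      rw [Nat.cast_zero, zero_mul] at hA
      linarith
    | succ r ih =>
      obtain ⟨d, hd⟩ := ih
      obtain ⟨n, hn⟩ := hinc d
      refine ⟨n, fun ι _ hι A hA hA' => ?_⟩
      obtain hl | ⟨S, hS⟩ := hn ι hι A hA
      · exact hl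
      · obtain ⟨l, hl⟩ := hd (Fin d) (by simp) {x | S x ∈ A} (by
          change _ ≤ avg fun x => ind (S x ∈ A)
          linarith) (by
          change _ < (avg fun x => ind (S x ∈ A)) + r * γ
          push_cast at hA'
          linarith)
        exact ⟨S.mapLine l, fun a => by
          rw [Subspace.mapLine_apply]
          exact hl a⟩
  obtain ⟨r, hr⟩ := exists_nat_gt (1 / γ)
  rw [div_lt_iff₀ hγ] at hr
  obtain ⟨n, hn⟩ := key r
  refine ⟨n, fun ι _ hι A hA => hn ι hι A ((min_le_left _ _).trans hA) ?_⟩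
  linarith

theorem DensityHalesJewett.of_equiv {α β : Type} [Finite α] [Finite β] (e : α ≃ β)
    (h : DensityHalesJewett α) : DensityHalesJewett β := by
  intro δ hδ
  obtain ⟨N, hN⟩ := h δ hδ
  refine ⟨N, fun ι _ hι A hA => ?_⟩
  rw [← avg_equiv (Equiv.arrowCongr (Equiv.refl ι) e)] at hA
  obtain ⟨l, hl⟩ := hN ι hι _ hA
  refine ⟨l.map e, fun b => ?_⟩
  have := hl (e.symm b)
  change (fun i => e (l (e.symm b) i)) ∈ A at this
  rw [← e.apply_symm_apply b, Line.map_apply]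
  exact this

theorem DensityHalesJewett.of_subsingleton (α : Type) [Finite α] [Subsingleton α] :
    DensityHalesJewett α := by
  refine fun δ hδ => ⟨1, fun ι _ hι A hA => ?_⟩
  have : Nonempty ι := (Nat.card_pos_iff.1 hι).1
  by_cases hne : ∃ x, x ∈ A
  · obtain ⟨x, hx⟩ := hne
    exact ⟨Line.diagonal α ι, fun a => by convert! hx⟩
  · push Not at hne
    simp only [hne, not_false_eq_true, ind_of_not, avg, finsum_zero, zero_div] at hA
    linarith

/-- The density Hales-Jewett theorem. -/
theorem densityHalesJewett (α : Type) [Finite α] : DensityHalesJewett α := by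
  refine (Finite.induction_empty_option (P := fun α => ∀ _ : Finite α, DensityHalesJewett α)
    ?_ ?_ ?_ α) ‹_›
  · intro α β e h _
    have := Finite.of_equiv β e.symm
    exact (h this).of_equiv e
  · exact fun _ => DensityHalesJewett.of_subsingleton _
  · intro α _ h _
    rcases isEmpty_or_nonempty α with _ | _
    · exact DensityHalesJewett.of_subsingleton _
    · exact (h inferInstance).option

theorem avg_ind_mem_finset {X : Type*} [Fintype X] (S : Finset X) :
    avg (fun x => ind (x ∈ S)) = S.card / Fintype.card X := by
  classical
  rw [avg_eq_sum]
  have h : ∀ x, ind (x ∈ S) = if x ∈ S then 1 else 0 := fun x => by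
    by_cases hx : x ∈ S <;> simp [hx]
  simp [h]

/-- Along a combinatorial line, a sum of additive contributions of the letters splits into a
constant and the contribution of the active coordinates. -/
theorem sum_line_apply {E η B H : Type*} [Fintype η] [AddCommGroup H] (L : Line E η)
    (ψ : η → B → H) (g : E → B) (e : E) :
    ∑ i, ψ i (g (L e i)) = (∑ i, (L.idxFun i).elim 0 fun a => ψ i (g a)) +
      ∑ i with L.idxFun i = none, ψ i (g e) := by
  classical
  rw [Finset.sum_filter, ← Finset.sum_add_distrib]
  refine Finset.sum_congr rfl fun i _ => ?_
  cases h : L.idxFun i <;> simp [h]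

/-- In a group containing a suitable system of commuting elements, dense sets of triples contain
a grid configuration. -/
theorem exists_spannedCount_ge {l : ℕ} (hl : 0 < l) {c : ℝ} (hc : 0 < c) :
    ∃ n : ℕ, ∀ (Γ : Type) [Group Γ] [Fintype Γ] [DecidableEq Γ] (B H : Type) [AddCommGroup B]
      [DecidableEq B] [AddCommGroup H] (j : H → Γ) (ψ : Fin n → B →+ H) (v : Fin l → B),
      (∀ a b, j (a + b) = j a * j b) →
      (∀ R : Finset (Fin n), R.Nonempty → Function.Injective fun d => j (∑ i ∈ R, ψ i (v d))) →
      (Finset.univ.image fun p : Fin l × Fin l => v p.1 + v p.2).card ≤ 3 * l →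
      ∀ S : Finset (Γ × Γ), c * (Fintype.card Γ : ℝ) ^ 2 ≤ (S.card : ℝ) →
        ∃ T : Finset Γ, T.card ≤ 5 * l ∧ l ^ 2 ≤ spannedCount S T := by
  obtain ⟨n, hn⟩ := densityHalesJewett (Fin l × Fin l) c hc
  refine ⟨n, fun Γ _ _ _ B H _ _ _ j ψ v hj hinj hv S hS => ?_⟩
  have hdense : c ≤ avg fun p : Γ × Γ => ind (p ∈ S) := by
    rw [avg_ind_mem_finset, Fintype.card_prod, le_div_iff₀ (by
      exact_mod_cast Nat.mul_pos Fintype.card_pos Fintype.card_pos)]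
    push_cast
    linarith
  let P : (Fin n → Fin l × Fin l) → Γ × Γ := fun w =>
    (j (∑ i, ψ i (v (w i).1)), j (∑ i, ψ i (v (w i).2)))
  have hshift : c ≤ avg fun p : Γ × Γ => avg fun w => ind ((p.1 * (P w).1, (P w).2 * p.2) ∈ S) := by
    rw [avg_comm]
    have : ∀ w, (avg fun p : Γ × Γ => ind ((p.1 * (P w).1, (P w).2 * p.2) ∈ S)) =
        avg fun p : Γ × Γ => ind (p ∈ S) := fun w =>
      avg_equiv (Equiv.prodCongr (Equiv.mulRight (P w).1) (Equiv.mulLeft (P w).2))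
        fun p => ind (p ∈ S)
    simp only [this]
    have : Nonempty (Fin l) := ⟨⟨0, hl⟩⟩
    rwa [avg_const]
  obtain ⟨⟨x, y⟩, hxy⟩ := exists_le_of_le_avg hshift
  obtain ⟨L, hL⟩ := hn (Fin n) (by simp) {w | (x * (P w).1, (P w).2 * y) ∈ S} hxy
  obtain ⟨i₀, hi₀⟩ := L.proper
  set R : Finset (Fin n) := {i | L.idxFun i = none} with hR
  have hinj := hinj R ⟨i₀, by simp [hR, hi₀]⟩
  set C := ∑ i, (L.idxFun i).elim 0 fun a => ψ i (v a.1)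
  set C' := ∑ i, (L.idxFun i).elim 0 fun a => ψ i (v a.2)
  let u : Fin l → Γ := fun d => x * j (C + ∑ i ∈ R, ψ i (v d))
  let u' : Fin l → Γ := fun d => j (C' + ∑ i ∈ R, ψ i (v d)) * y
  have hmem : ∀ p : Fin l × Fin l, (u p.1, u' p.2) ∈ S := by
    intro p
    have := hL p
    change (x * j (∑ i, ψ i (v (L p i).1)), j (∑ i, ψ i (v (L p i).2)) * y) ∈ S at this
    rwa [sum_line_apply L (fun i => ψ i) (fun e => v e.1),
      sum_line_apply L (fun i => ψ i) (fun e => v e.2)] at this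
  have hu : Function.Injective u := fun d d' h => hinj (by
    simpa only [u, hj, mul_right_inj] using h)
  have hu' : Function.Injective u' := fun d d' h => hinj (by
    simpa only [u', hj, mul_right_inj, mul_left_inj] using h)
  let z : B → Γ := fun b => x * j (C + C' + ∑ i ∈ R, ψ i b) * y
  have hz : ∀ d d', u d * u' d' = z (v d + v d') := by
    intro d d'
    have : C + C' + ∑ i ∈ R, ψ i (v d + v d') =
        (C + ∑ i ∈ R, ψ i (v d)) + (C' + ∑ i ∈ R, ψ i (v d')) := by
      simp only [map_add, Finset.sum_add_distrib]
      abel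
    simp only [z, this, u, u']
    rw [hj (C + _)]
    simp only [mul_assoc]
  refine ⟨Finset.univ.image u ∪ Finset.univ.image u' ∪
    (Finset.univ.image fun p : Fin l × Fin l => v p.1 + v p.2).image z, ?_, ?_⟩
  · have h1 := Finset.card_union_le (Finset.univ.image u ∪ Finset.univ.image u')
      ((Finset.univ.image fun p : Fin l × Fin l => v p.1 + v p.2).image z)
    have h2 := Finset.card_union_le (Finset.univ.image u) (Finset.univ.image u')
    have h3 : (Finset.univ.image u).card ≤ l := Finset.card_image_le.trans (by simp)
    have h4 : (Finset.univ.image u').card ≤ l := Finset.card_image_le.trans (by simp)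
    have h5 : ((Finset.univ.image fun p : Fin l × Fin l => v p.1 + v p.2).image z).card ≤ 3 * l :=
      Finset.card_image_le.trans hv
    omega
  · have hcard : (Finset.univ.image fun p : Fin l × Fin l => (u p.1, u' p.2)).card = l ^ 2 := by
      rw [Finset.card_image_of_injective _
        (show Function.Injective fun p : Fin l × Fin l => (u p.1, u' p.2) from hu.prodMap hu'),
        Finset.card_univ, Fintype.card_prod,
        Fintype.card_fin, sq]
    rw [← hcard]
    refine Finset.card_le_card fun q hq => ?_
    obtain ⟨p, -, rfl⟩ := Finset.mem_image.1 hq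
    refine Finset.mem_filter.2 ⟨hmem p, ?_, ?_, ?_⟩
    · simp
    · simp
    · rw [hz]
      exact Finset.mem_union_right _ (Finset.mem_image_of_mem _
        (Finset.mem_image_of_mem (fun p : Fin l × Fin l => v p.1 + v p.2) (Finset.mem_univ p)))

/-- Finite abelian groups contain sets of small doubling of every possible size. -/
theorem exists_small_doubling {B : Type*} [AddCommGroup B] [Fintype B] [DecidableEq B] {l : ℕ}
    (hl : 0 < l) (hB : l ≤ Fintype.card B) :
    ∃ v : Fin l → B, Function.Injective v ∧
      (Finset.univ.image fun p : Fin l × Fin l => v p.1 + v p.2).card ≤ 3 * l := by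
  classical
  suffices h : ∃ U V : Finset B, l ≤ U.card ∧ V.card ≤ 3 * l ∧ ∀ a ∈ U, ∀ b ∈ U, a + b ∈ V by
    obtain ⟨U, V, hU, hV, hUV⟩ := h
    obtain ⟨e⟩ : Nonempty (Fin l ↪ U) := by
      rw [Function.Embedding.nonempty_iff_card_le]
      simpa
    refine ⟨fun i => e i, fun a b h => e.injective (Subtype.ext h), le_trans ?_ hV⟩
    refine Finset.card_le_card fun x hx => ?_
    obtain ⟨p, -, rfl⟩ := Finset.mem_image.1 hx
    exact hUV _ (e p.1).2 _ (e p.2).2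
  obtain ⟨K, hKl, hK⟩ : ∃ K : AddSubgroup B, Nat.card K ≤ l ∧
      ∀ K' : AddSubgroup B, Nat.card K' ≤ l → Nat.card K' ≤ Nat.card K := by
    have : Nonempty {K : AddSubgroup B // Nat.card K ≤ l} :=
      ⟨⊥, by simpa using Nat.one_le_iff_ne_zero.2 hl.ne'⟩
    obtain ⟨K, hK⟩ := Finite.exists_max fun K : {K : AddSubgroup B // Nat.card K ≤ l} =>
      Nat.card K.1
    exact ⟨K.1, K.2, fun K' h => hK ⟨K', h⟩⟩
  let W : B → Finset B := fun c => {b | b - c ∈ K}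
  have hW : ∀ c, (W c).card = Nat.card K := by
    intro c
    rw [Nat.card_eq_fintype_card, Fintype.card_subtype]
    refine Eq.trans ?_ (Finset.card_map (addRightEmbedding c))
    congr 1
    ext b
    simp [W, eq_sub_iff_add_eq.symm]
  rcases hKl.eq_or_lt with hKl | hKl
  · refine ⟨W 0, W 0, (hKl ▸ hW 0).ge, by rw [hW]; omega, fun a ha b hb => ?_⟩
    simp only [W, Finset.mem_filter_univ, sub_zero] at ha hb ⊢
    exact K.add_mem ha hb
  obtain ⟨x, hx⟩ : ∃ x, x ∉ K := by
    by_contra! h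
    rw [(AddSubgroup.eq_top_iff' K).2 h, AddSubgroup.card_top, Nat.card_eq_fintype_card] at hKl
    omega
  let U : ℕ → Finset B := fun j => {b | ∃ t < j, b - t • x ∈ K}
  have hU : ∃ j, l ≤ (U j).card := by
    have hlt : l < Nat.card (K ⊔ AddSubgroup.zmultiples x : AddSubgroup B) := by
      by_contra! h
      have h1 : K = K ⊔ AddSubgroup.zmultiples x :=
        AddSubgroup.eq_of_le_of_card_ge le_sup_left (hK _ h)
      refine hx ?_
      rw [h1]
      exact AddSubgroup.mem_sup_right (AddSubgroup.mem_zmultiples x)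
    refine ⟨addOrderOf x, hlt.le.trans ?_⟩
    rw [Nat.card_eq_fintype_card, Fintype.card_subtype]
    refine Finset.card_le_card fun b hb => ?_
    rw [Finset.mem_filter_univ, AddSubgroup.mem_sup] at hb
    obtain ⟨k, hk, z, hz, rfl⟩ := hb
    rw [mem_zmultiples_iff_mem_range_addOrderOf, Finset.mem_image] at hz
    obtain ⟨t, ht, rfl⟩ := hz
    rw [Finset.mem_filter_univ]
    exact ⟨t, Finset.mem_range.1 ht, by simpa using hk⟩
  obtain ⟨j, hj⟩ : ∃ j, Nat.find hU = j + 1 := by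
    refine Nat.exists_eq_succ_of_ne_zero fun h => ?_
    have := Nat.find_spec hU
    rw [h] at this
    simp [U] at this
    omega
  have hjl : (U j).card < l := not_le.1 (Nat.find_min hU (by omega))
  refine ⟨U (j + 1), U (2 * j + 1), hj ▸ Nat.find_spec hU, ?_, fun a ha b hb => ?_⟩
  · have hsub : U (2 * j + 1) ⊆ U j ∪ (U j).image (· + j • x) ∪ W ((2 * j) • x) := by
      intro b hb
      simp only [U, W, Finset.mem_union, Finset.mem_filter_univ, Finset.mem_image] at hb ⊢
      obtain ⟨t, ht, hb⟩ := hb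
      rcases lt_or_ge t j with h1 | h1
      · exact Or.inl (Or.inl ⟨t, h1, hb⟩)
      rcases eq_or_ne t (2 * j) with rfl | h2
      · exact Or.inr hb
      refine Or.inl (Or.inr ⟨b - j • x, ⟨t - j, by omega, ?_⟩, by simp⟩)
      rwa [sub_sub, ← add_smul, Nat.add_sub_cancel' h1]
    have h1 := Finset.card_le_card hsub
    have h2 := Finset.card_union_le (U j ∪ (U j).image (· + j • x)) (W ((2 * j) • x))
    have h3 := Finset.card_union_le (U j) ((U j).image (· + j • x))
    have h4 : ((U j).image (· + j • x)).card ≤ (U j).card := Finset.card_image_le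
    rw [hW] at h2
    omega
  · simp only [U, Finset.mem_filter_univ] at ha hb ⊢
    obtain ⟨t, ht, ha⟩ := ha
    obtain ⟨t', ht', hb⟩ := hb
    refine ⟨t + t', by omega, ?_⟩
    have := K.add_mem ha hb
    rwa [sub_add_sub_comm, ← add_smul] at this

/-- A finite group of large order all of whose elements have small order has a large Sylow
subgroup. -/
theorem exists_large_sylow {G : Type*} [Group G] [Finite G] {M t : ℕ} (ht : 0 < t)
    (hM : ∀ g : G, orderOf g < M) (hG : t ^ M < Nat.card G) :
    ∃ p : ℕ, ∃ _ : Fact p.Prime, p < M ∧ ∃ P : Sylow p G, t ≤ Nat.card P := by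
  have := Fintype.ofFinite G
  by_contra! h
  refine hG.not_ge ?_
  have hlt : ∀ p ∈ (Nat.card G).primeFactors, p < M := by
    intro p hp
    have : Fact p.Prime := ⟨Nat.prime_of_mem_primeFactors hp⟩
    obtain ⟨x, rfl⟩ := exists_prime_orderOf_dvd_card p
      (Nat.card_eq_fintype_card (α := G) ▸ Nat.dvd_of_mem_primeFactors hp)
    exact hM x
  have hsub : (Nat.card G).primeFactors ⊆ Finset.range M := fun p hp =>
    Finset.mem_range.2 (hlt p hp)
  calc Nat.card G = ∏ p ∈ (Nat.card G).primeFactors, p ^ (Nat.card G).factorization p :=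
        (Nat.prod_factorization_pow_eq_self Nat.card_pos.ne').symm
    _ ≤ ∏ _p ∈ (Nat.card G).primeFactors, t := by
        refine Finset.prod_le_prod' fun p hp => ?_
        have hpp : Fact p.Prime := ⟨Nat.prime_of_mem_primeFactors hp⟩
        obtain ⟨P⟩ : Nonempty (Sylow p G) := inferInstance
        rw [← Sylow.card_eq_multiplicity P]
        exact (h p hpp (hlt p hp) P).le
    _ = t ^ (Nat.card G).primeFactors.card := Finset.prod_const t
    _ ≤ t ^ M := Nat.pow_le_pow_right ht (by simpa using Finset.card_le_card hsub)

/-- Large `p`-groups contain large abelian groups. -/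
theorem exists_large_commGroup {p : ℕ} [Fact p.Prime] {t : ℕ} (ht : 0 < t) (r : ℕ) :
    ∀ (P : Type) [Group P] [Finite P], IsPGroup p P → t ≤ Nat.card (Subgroup.center P) + r →
      t ^ (r + 1) ≤ Nat.card P →
      ∃ (A : Type) (_ : CommGroup A) (_ : Finite A) (f : A →* P), Function.Injective f ∧
        t ≤ Nat.card A := by
  induction r with
  | zero =>
    intro P _ _ _ hZ _
    exact ⟨Subgroup.center P, IsMulCommutative.instCommGroup, inferInstance,
      (Subgroup.center P).subtype, Subtype.val_injective, hZ⟩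
  | succ r ih =>
    intro P _ _ hP hZ hcard
    by_cases hZt : t ≤ Nat.card (Subgroup.center P)
    · exact ⟨Subgroup.center P, IsMulCommutative.instCommGroup, inferInstance,
      (Subgroup.center P).subtype, Subtype.val_injective, hZt⟩
    push Not at hZt
    have hne : Nontrivial (P ⧸ Subgroup.center P) := by
      rw [QuotientGroup.nontrivial_iff]
      intro h
      rw [h, Subgroup.card_top] at hZt
      have := Nat.le_self_pow (n := r + 1 + 1) (by omega) t
      omega
    have := (hP.to_quotient (Subgroup.center P)).center_nontrivial
    obtain ⟨⟨y, hy⟩, hy1⟩ := exists_ne (1 : Subgroup.center (P ⧸ Subgroup.center P))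
    obtain ⟨x, rfl⟩ := QuotientGroup.mk_surjective y
    have hx : x ∉ Subgroup.center P := fun h => hy1 (Subtype.ext
      ((QuotientGroup.eq_one_iff x).2 h))
    have hcomm : ∀ g, g * x * g⁻¹ * x⁻¹ ∈ Subgroup.center P := by
      intro g
      rw [← QuotientGroup.eq_one_iff]
      have := Subgroup.mem_center_iff.1 hy g
      simp only [QuotientGroup.mk_mul, QuotientGroup.mk_inv, this]
      group
    let F : P →* Subgroup.center P := MonoidHom.mk' (fun g => ⟨g * x * g⁻¹ * x⁻¹, hcomm g⟩) (by
      intro g h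
      refine Subtype.ext ?_
      have := Subgroup.mem_center_iff.1 (hcomm h) g
      calc g * h * x * (g * h)⁻¹ * x⁻¹ = g * (h * x * h⁻¹ * x⁻¹) * (x * g⁻¹ * x⁻¹) := by group
        _ = (h * x * h⁻¹ * x⁻¹) * (g * x * g⁻¹ * x⁻¹) := by rw [this]; group
        _ = (g * x * g⁻¹ * x⁻¹) * (h * x * h⁻¹ * x⁻¹) :=
          (Subgroup.mem_center_iff.1 (hcomm h) _).symm)
    have hF : ∀ g, g ∈ F.ker ↔ g * x = x * g := by
      intro g
      rw [MonoidHom.mem_ker, Subtype.ext_iff]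
      change g * x * g⁻¹ * x⁻¹ = 1 ↔ _
      rw [mul_inv_eq_one, mul_inv_eq_iff_eq_mul]
    have hZF : Subgroup.center P ≤ F.ker := fun g hg =>
      (hF g).2 (Subgroup.mem_center_iff.1 hg x).symm
    have hker : t ^ (r + 1) ≤ Nat.card F.ker := by
      have h1 := F.ker.card_mul_index
      rw [Subgroup.index_ker] at h1
      have h2 := Subgroup.card_le_card_group F.range
      have h3 : Nat.card F.ker * Nat.card F.range ≤ Nat.card F.ker * t :=
        Nat.mul_le_mul_left _ (by omega)
      rw [h1] at h3
      rw [pow_succ] at hcard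
      exact Nat.le_of_mul_le_mul_right (hcard.trans h3) ht
    have hcen : Nat.card (Subgroup.center P) < Nat.card (Subgroup.center F.ker) := by
      have hle : Subgroup.center P < (Subgroup.center F.ker).map F.ker.subtype := by
        refine lt_of_le_of_ne (fun g hg => ?_) fun h => hx ?_
        · refine ⟨⟨g, hZF hg⟩, Subgroup.mem_center_iff.2 fun h => Subtype.ext ?_, rfl⟩
          exact Subgroup.mem_center_iff.1 hg h
        · rw [h]
          refine ⟨⟨x, (hF x).2 rfl⟩, Subgroup.mem_center_iff.2 fun h => Subtype.ext ?_, rfl⟩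
          exact (hF h).1 h.2
      rw [← Subgroup.card_map_of_injective F.ker.subtype_injective]
      by_contra! hcon
      exact hle.ne (Subgroup.eq_of_le_of_card_ge hle.le hcon)
    obtain ⟨A, _, _, f, hf, hA⟩ := ih F.ker (hP.to_subgroup _) (by omega) hker
    exact ⟨A, _, ‹_›, F.ker.subtype.comp f, F.ker.subtype_injective.comp hf, hA⟩

/-- The torsion of a finite abelian group of exponent dividing `p ^ e` is large. -/
theorem card_le_card_ker_pow (p e : ℕ) : ∀ (A : Type) [CommGroup A] [Finite A],
    (∀ a : A, a ^ p ^ e = 1) → Nat.card A ≤ Nat.card (powMonoidHom p : A →* A).ker ^ e := by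
  induction e with
  | zero =>
    intro A _ _ h
    have : Subsingleton A := ⟨fun a b => by simpa using (h a).trans (h b).symm⟩
    simp
  | succ e ih =>
    intro A _ _ h
    have h1 := (powMonoidHom p : A →* A).ker.card_mul_index
    rw [Subgroup.index_ker] at h1
    have h2 := ih (powMonoidHom p : A →* A).range (by
      rintro ⟨_, a, rfl⟩
      refine Subtype.ext ?_
      simpa [← pow_mul, ← pow_succ'] using h a)
    have h3 : Nat.card (powMonoidHom p : (powMonoidHom p : A →* A).range →* _).ker ≤
        Nat.card (powMonoidHom p : A →* A).ker := by
      refine Nat.card_le_card_of_injective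
        (fun a => ⟨a.1.1, congrArg Subtype.val a.2⟩) fun a b h => ?_
      exact Subtype.ext (Subtype.ext
        (congrArg (fun x : (powMonoidHom p : A →* A).ker => (x : A)) h))
    rw [← h1, pow_succ']
    exact Nat.mul_le_mul_left _ (h2.trans (Nat.pow_le_pow_left h3 e))

theorem exists_injective_of_exponent_prime {p : ℕ} [Fact p.Prime] {V κ : Type*} [AddCommGroup V]
    [Finite V] [Fintype κ] (hV : ∀ x : V, p • x = 0) (hcard : p ^ Fintype.card κ ≤ Nat.card V) :
    ∃ Φ : (κ → ZMod p) →+ V, Function.Injective Φ := by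
  classical
  let : Module (ZMod p) V := AddCommGroup.zmodModule hV
  have := Fintype.ofFinite V
  have hrank : Fintype.card κ ≤ Module.finrank (ZMod p) V := by
    rw [Nat.card_eq_fintype_card, Module.card_eq_pow_finrank (K := ZMod p) (V := V), ZMod.card]
      at hcard
    exact (Nat.pow_le_pow_iff_right (Fact.out : p.Prime).one_lt).1 hcard
  obtain ⟨b, hb⟩ := exists_linearIndependent_of_le_finrank hrank
  exact ⟨(Fintype.linearCombination (ZMod p) (b ∘ Fintype.equivFin κ)).toAddMonoidHom,
    linearIndependent_iff_injective_fintypeLinearCombination.1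
      (hb.comp _ (Fintype.equivFin κ).injective)⟩

/-- A large finite group all of whose elements have small order contains elementary abelian
groups of large rank. -/
theorem exists_elementary_abelian (M N : ℕ) : ∃ n₀ : ℕ, ∀ (G : Type) [Group G] [Finite G],
    (∀ g : G, orderOf g < M) → n₀ ≤ Nat.card G → ∀ κ : Type, [Fintype κ] → Fintype.card κ ≤ N →
      ∃ (p : ℕ) (_ : Fact p.Prime) (j : (κ → ZMod p) → G), Function.Injective j ∧
        ∀ a b, j (a + b) = j a * j b := by
  classical
  rcases Nat.eq_zero_or_pos M with rfl | hM0
  · exact ⟨0, fun G _ _ h => absurd (h 1) (Nat.not_lt_zero _)⟩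
  set u := (M ^ N) ^ M with hu
  have hu0 : 0 < u := by positivity
  set t := u ^ (u + 1) with ht
  have ht0 : 0 < t := by positivity
  refine ⟨t ^ M + 1, fun G _ _ hM hG κ _ hκ => ?_⟩
  obtain ⟨p, hp, hpM, P, hP⟩ := exists_large_sylow ht0 hM hG
  obtain ⟨A, _, _, f, hf, hA⟩ := exists_large_commGroup hu0 u P P.2 (by omega) hP
  have hpow : ∀ a : A, a ^ p ^ M = 1 := by
    intro a
    obtain ⟨k, hk⟩ := (IsPGroup.iff_orderOf.1 P.2) (f a)
    have h1 : orderOf a = p ^ k := by rw [← hk, orderOf_injective f hf]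
    have h2 : orderOf a < M := by
      have := hM ((P : Subgroup G).subtype (f a))
      rwa [orderOf_injective _ (P : Subgroup G).subtype_injective, orderOf_injective f hf] at this
    refine orderOf_dvd_iff_pow_eq_one.1 ?_
    rw [h1]
    have := Nat.lt_pow_self (n := k) hp.1.one_lt
    exact pow_dvd_pow p (by omega)
  have hker := card_le_card_ker_pow p M A hpow
  set K := (powMonoidHom p : A →* A).ker
  have hK : M ^ N ≤ Nat.card K := by
    refine (Nat.pow_le_pow_iff_left (n := M) hM0.ne').1 ?_
    omega
  obtain ⟨Φ, hΦ⟩ := exists_injective_of_exponent_prime (p := p) (V := Additive K) (κ := κ) (by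
    rintro ⟨a, ha⟩
    exact Subtype.ext ha)
    ((Nat.pow_le_pow_right hp.1.pos hκ).trans ((Nat.pow_le_pow_left hpM.le N).trans hK))
  refine ⟨p, hp, fun a => (P : Subgroup G).subtype (f (K.subtype (Φ a).toMul)), ?_, fun a b => ?_⟩
  · exact (P : Subgroup G).subtype_injective.comp (hf.comp (K.subtype_injective.comp
      (Additive.toMul.injective.comp hΦ)))
  · simp only [map_add, toMul_add, map_mul]

theorem stmt_2 (k : ℕ) (hk : 3 ≤ k) (c : ℝ) (hc : 0 < c) :
    ∃ n₀ : ℕ, ∀ (Γ : Type) [Group Γ] [Fintype Γ] [DecidableEq Γ],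
      n₀ ≤ Fintype.card Γ →
      ∀ S : Finset (Γ × Γ), c * (Fintype.card Γ : ℝ) ^ 2 ≤ (S.card : ℝ) →
        ∃ T : Finset Γ, (T.card : ℝ) ≤ 8 * Real.sqrt k ∧ k ≤ spannedCount S T := by
  classical
  set l := ⌈Real.sqrt k⌉₊
  have hk3 : (3 : ℝ) ≤ k := by exact_mod_cast hk
  have hsqrt : 5 / 3 ≤ Real.sqrt k := Real.le_sqrt_of_sq_le (by linarith)
  have hl : 0 < l := Nat.ceil_pos.2 (by linarith)
  have hkl : k ≤ l ^ 2 := by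
    have : (k : ℝ) ≤ (l : ℝ) ^ 2 := (Real.sqrt_le_left (Nat.cast_nonneg l)).1 (Nat.le_ceil _)
    exact_mod_cast this
  have hl8 : (5 * l : ℝ) ≤ 8 * Real.sqrt k := by
    have : (l : ℝ) < Real.sqrt k + 1 := Nat.ceil_lt_add_one (Real.sqrt_nonneg _)
    linarith
  obtain ⟨n, hn⟩ := exists_spannedCount_ge hl hc
  obtain ⟨n₀, hn₀⟩ := exists_elementary_abelian (n * l + 1) (n * l)
  refine ⟨n₀, fun Γ _ _ _ hΓ S hS => ?_⟩
  suffices h : ∃ T : Finset Γ, T.card ≤ 5 * l ∧ l ^ 2 ≤ spannedCount S T by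
    obtain ⟨T, hT, hT'⟩ := h
    have : (T.card : ℝ) ≤ 5 * l := by exact_mod_cast hT
    exact ⟨T, this.trans hl8, hkl.trans hT'⟩
  by_cases hord : ∀ g : Γ, orderOf g < n * l + 1
  · obtain ⟨p, _, j, hj, hadd⟩ := hn₀ Γ hord (by rwa [Nat.card_eq_fintype_card]) (Fin n × Fin l)
      (by simp)
    obtain ⟨v, hv, hvv⟩ := exists_small_doubling (B := Fin l → ZMod p) hl (by
      rw [Fintype.card_fun, ZMod.card, Fintype.card_fin]
      exact (Nat.lt_pow_self (Fact.out : p.Prime).one_lt).le)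
    let ψ : Fin n → (Fin l → ZMod p) →+ (Fin n × Fin l → ZMod p) := fun i =>
      { toFun := fun b q => if q.1 = i then b q.2 else 0
        map_zero' := by ext; simp
        map_add' := fun a b => by ext q; by_cases h : q.1 = i <;> simp [h] }
    refine hn Γ _ _ j ψ v hadd (fun R ⟨i, hi⟩ => ?_) hvv S hS
    refine hj.comp (Function.Injective.comp (g := fun b => ∑ i ∈ R, ψ i b) (fun a b h => ?_) hv)
    funext t
    have := congrFun h (i, t)
    simpa [ψ, Finset.sum_apply, hi] using this
  · push Not at hord
    obtain ⟨g, hg⟩ := hord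
    refine hn Γ ℤ ℤ (fun m => g ^ m) (fun _ => AddMonoidHom.id ℤ) (fun i => ((i : ℕ) : ℤ))
      (fun a b => zpow_add g a b) (fun R hR i i' h => ?_) ?_ S hS
    · simp only [AddMonoidHom.id_apply, Finset.sum_const, nsmul_eq_mul] at h
      have hRn : R.card ≤ n := by simpa using R.card_le_univ
      have hlt : ∀ i : Fin l, R.card * (i : ℕ) < orderOf g := fun i =>
        lt_of_le_of_lt (Nat.mul_le_mul hRn i.2.le) hg
      have := pow_injOn_Iio_orderOf (x := g) (hlt i) (hlt i') (by exact_mod_cast h)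
      exact Fin.ext (Nat.eq_of_mul_eq_mul_left hR.card_pos this)
    · have hsub : (Finset.univ.image fun p : Fin l × Fin l => ((p.1 : ℕ) : ℤ) + ((p.2 : ℕ) : ℤ)) ⊆
          (Finset.range (3 * l)).image fun i : ℕ => (i : ℤ) := by
        intro x hx
        obtain ⟨p, -, rfl⟩ := Finset.mem_image.1 hx
        refine Finset.mem_image.2 ⟨p.1 + p.2, Finset.mem_range.2 ?_, by simp⟩
        omega
      exact (Finset.card_le_card hsub).trans (Finset.card_image_le.trans (by simp))
end

section
/- For every integer k ≥ 3 and every real c > 0, there exists n₀ ∈ ℕ such that for every n ≥ n₀ and every set S ⊆ (ℤ/nℤ) × (ℤ/nℤ) with |S| ≥ c·n², there exists a subset T ⊆ ℤ/nℤ with |T| ≤ g(k) such that the number of pairs (a,b) ∈ S with a ∈ T, b ∈ T and a + b ∈ T is at least k. -/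
/-- `gP P` is the number of distinct first coordinates of `P`, plus the number of distinct
second coordinates of `P`, plus the number of distinct values `x + y` over `(x,y) ∈ P`. -/
def gP (P : Finset (ℤ × ℤ)) : ℕ :=
  (P.image Prod.fst).card + (P.image Prod.snd).card + (P.image (fun p => p.1 + p.2)).card

/-- `gmin k` is the minimum of `gP P` over all sets `P ⊆ ℤ × ℤ` with `|P| = k`. -/
noncomputable def gmin (k : ℕ) : ℕ := sInf {m | ∃ P : Finset (ℤ × ℤ), P.card = k ∧ gP P = m}

open scoped BigOperators

/-- The uniform density of a subset of a finite type. -/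
noncomputable def uniformDensity {X : Type} [Fintype X] (A : Set X) : ℝ :=
  𝔼 x, A.indicator 1 x

section Averages

variable {X Y : Type} [Fintype X] [Fintype Y]

theorem expect_mono {f g : X → ℝ} (h : ∀ x, f x ≤ g x) : 𝔼 x, f x ≤ 𝔼 x, g x :=
  Finset.expect_le_expect fun x _ => h x

theorem expect_expect_comm (f : X → Y → ℝ) : 𝔼 x, 𝔼 y, f x y = 𝔼 y, 𝔼 x, f x y :=
  Finset.expect_comm _ _ _

theorem expect_prod (f : X × Y → ℝ) : 𝔼 p, f p = 𝔼 x, 𝔼 y, f (x, y) := by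
  rw [← Finset.univ_product_univ, Finset.expect_product]

theorem expect_append {κ : Type} [Fintype κ] {m n : ℕ} (h : (Fin (m + n) → κ) → ℝ) :
    𝔼 z, h z = 𝔼 x, 𝔼 y, h (Fin.append x y) := by
  rw [← expect_prod fun p : (Fin m → κ) × (Fin n → κ) => h (Fin.append p.1 p.2)]
  exact (Fintype.expect_equiv (Fin.appendEquiv m n) _ _ fun _ => rfl).symm

theorem uniformDensity_nonneg (A : Set X) : 0 ≤ uniformDensity A :=
  Finset.expect_nonneg fun x _ => Set.indicator_nonneg (fun _ _ => zero_le_one) x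

theorem exists_mem_of_uniformDensity_pos {A : Set X} (h : 0 < uniformDensity A) :
    ∃ x, x ∈ A := by
  by_contra! hA
  simp [uniformDensity, Set.eq_empty_iff_forall_notMem.2 hA] at h

theorem inv_card_le_uniformDensity {A : Set X} {x : X} (hx : x ∈ A) :
    (Fintype.card X : ℝ)⁻¹ ≤ uniformDensity A := by
  have h : (1 : ℝ) ≤ ∑ y, A.indicator 1 y := by
    have := Finset.single_le_sum (f := A.indicator (1 : X → ℝ))
      (fun y _ => Set.indicator_nonneg (fun _ _ => zero_le_one) y) (Finset.mem_univ x)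
    simpa [hx] using this
  rw [uniformDensity, Fintype.expect_eq_sum_div_card, inv_eq_one_div]
  gcongr

/-- A function bounded by one with average at least `2 * q` is at least `q` on a set of density at
least `q`. -/
theorem le_uniformDensity_of_le_expect [Nonempty X] {f : X → ℝ} (hf : ∀ x, f x ≤ 1) {q : ℝ}
    (hq : 0 ≤ q) (h : 2 * q ≤ 𝔼 x, f x) : q ≤ uniformDensity {x | q ≤ f x} := by
  have : 𝔼 x, f x ≤ 𝔼 x, (Set.indicator {x | q ≤ f x} 1 x + q) := expect_mono fun x => by
    by_cases hx : q ≤ f x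
    · simp [hx]; linarith [hf x]
    · simp [hx]; linarith
  rw [Finset.expect_add_distrib, Fintype.expect_const] at this
  unfold uniformDensity
  linarith

/-- Pigeonhole principle: among finitely many labels, one is admissible for many points. -/
theorem exists_popular {W : Type} [Fintype W] {G : Set X} {q : ℝ} (hq : 0 < q)
    (hG : q ≤ uniformDensity G) {Q : W → X → Prop} (h : ∀ x ∈ G, ∃ w, Q w x) :
    ∃ w, q / Fintype.card W ≤ uniformDensity {x | Q w x} := by
  obtain ⟨x₀, hx₀⟩ := exists_mem_of_uniformDensity_pos (hq.trans_le hG)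
  have : Nonempty W := ⟨(h x₀ hx₀).choose⟩
  have hW : (0 : ℝ) < Fintype.card W := by exact_mod_cast Fintype.card_pos
  have h1 : uniformDensity G ≤ ∑ w, uniformDensity {x | Q w x} := by
    unfold uniformDensity
    rw [← Finset.expect_sum_comm]
    refine expect_mono fun x => ?_
    have hnn : ∀ w : W, (0 : ℝ) ≤ Set.indicator {x | Q w x} 1 x := fun w =>
      Set.indicator_nonneg (fun _ _ => zero_le_one) x
    by_cases hx : x ∈ G
    · obtain ⟨w, hw⟩ := h x hx
      have := Finset.single_le_sum (f := fun w => Set.indicator {x | Q w x} (1 : X → ℝ) x)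
        (fun w _ => hnn w) (Finset.mem_univ w)
      simpa [hx, hw] using this
    · simpa [hx] using Finset.sum_nonneg fun w _ => hnn w
  by_contra! hlt
  have h2 : ∑ w : W, uniformDensity {x | Q w x} < ∑ _w : W, q / Fintype.card W :=
    Finset.sum_lt_sum_of_nonempty Finset.univ_nonempty fun w _ => hlt w
  rw [Finset.sum_const, Finset.card_univ, nsmul_eq_mul, mul_div_cancel₀ _ hW.ne'] at h2
  linarith

/-- Rerandomizing one coordinate does not change an average. -/
theorem expect_update {ι : Type} [Fintype ι] [DecidableEq ι] (j : ι) (F : (ι → X) → ℝ)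
    [Nonempty X] : 𝔼 u, 𝔼 z, F (Function.update u j z) = 𝔼 u, F u := by
  rw [← expect_prod fun p : (ι → X) × X => F (Function.update p.1 j p.2)]
  let e : (ι → X) × X ≃ (ι → X) × X :=
    Function.Involutive.toPerm (fun p => (Function.update p.1 j p.2, p.1 j)) fun p => by simp
  refine (Fintype.expect_equiv e _ (fun p => F p.1) fun p => rfl).trans ?_
  rw [expect_prod]
  exact Finset.expect_congr rfl fun u _ => Fintype.expect_const (F u)

/-- If an average over `X` is almost as large as a uniform upper bound, then so is every term. -/
theorem sub_le_of_expect_ge [Nonempty X] {f : X → ℝ} {s ε : ℝ} (hε : 0 ≤ ε)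
    (hf : ∀ x, f x ≤ s + ε / (2 * Fintype.card X))
    (h : s - ε / (2 * Fintype.card X) ≤ 𝔼 x, f x) (x₀ : X) : s - ε ≤ f x₀ := by
  classical
  have hK : (1 : ℝ) ≤ Fintype.card X := by exact_mod_cast Fintype.card_pos
  set K : ℝ := (Fintype.card X : ℝ)
  set e := ε / (2 * K) with he
  have he0 : 0 ≤ e := by positivity
  have heK : ε = 2 * K * e := by rw [he]; field_simp
  rw [Fintype.expect_eq_sum_div_card, le_div_iff₀ (by positivity)] at h
  rw [← Finset.add_sum_erase _ _ (Finset.mem_univ x₀)] at h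
  have h2 : ∑ x ∈ Finset.univ.erase x₀, f x ≤ (K - 1) * (s + e) := by
    refine (Finset.sum_le_sum fun x _ => hf x).trans ?_
    rw [Finset.sum_const, Finset.card_erase_of_mem (Finset.mem_univ _), Finset.card_univ,
      nsmul_eq_mul, Nat.cast_sub Fintype.card_pos]
    simp [K]
  nlinarith

end Averages

/-- A class of functions closed under restriction to fibres attains a limiting maximal average, and
near-extremal functions in the class have near-extremal averages on all fibres. -/
theorem exists_extremal {κ : Type} [Fintype κ] [Nonempty κ] (C : ∀ n, Set ((Fin n → κ) → ℝ))
    (hC : ∀ n, ∀ h ∈ C n, ∀ x, h x ≤ 1)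
    (hfib : ∀ m n, ∀ h ∈ C (m + n), ∀ x, (fun y => h (Fin.append x y)) ∈ C n)
    {s : ℝ} (hs : ∀ n, ∃ h ∈ C n, s ≤ 𝔼 x, h x) :
    ∃ t, s ≤ t ∧ (∀ ε > 0, ∃ M, ∀ n, M ≤ n → ∀ h ∈ C n, 𝔼 x, h x ≤ t + ε) ∧
      ∀ m N, ∀ ε > 0, ∃ n, N ≤ n ∧ ∃ h ∈ C (m + n), ∀ x, t - ε ≤ 𝔼 y, h (Fin.append x y) := by
  set σ : ℕ → ℝ := fun n => sSup ((fun h => 𝔼 x, h x) '' C n) with hσ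
  have hbdd : ∀ n, BddAbove ((fun h : (Fin n → κ) → ℝ => 𝔼 x, h x) '' C n) := fun n =>
    ⟨1, by
      rintro _ ⟨h, hh, rfl⟩
      exact (expect_mono (hC n h hh)).trans (by rw [Fintype.expect_const])⟩
  have hle : ∀ n, ∀ h ∈ C n, 𝔼 x, h x ≤ σ n := fun n h hh => le_csSup (hbdd n) ⟨h, hh, rfl⟩
  have hanti : Antitone σ := by
    intro n k hnk
    obtain ⟨m, rfl⟩ := Nat.exists_eq_add_of_le' hnk
    obtain ⟨h₀, hh₀, -⟩ := hs (m + n)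
    refine csSup_le ⟨_, h₀, hh₀, rfl⟩ ?_
    rintro _ ⟨h, hh, rfl⟩
    simp only [expect_append]
    refine (expect_mono fun x => hle n _ (hfib m n h hh x)).trans ?_
    rw [Fintype.expect_const]
  have hσs : ∀ n, s ≤ σ n := fun n => by
    obtain ⟨h, hh, hsh⟩ := hs n
    exact hsh.trans (hle n h hh)
  have hσb : BddBelow (Set.range σ) := ⟨s, by rintro _ ⟨n, rfl⟩; exact hσs n⟩
  have hfirst : ∀ ε > 0, ∃ M, ∀ n, M ≤ n → ∀ h ∈ C n, 𝔼 x, h x ≤ (⨅ n, σ n) + ε := by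
    intro ε hε
    obtain ⟨M, hM⟩ := exists_lt_of_ciInf_lt (lt_add_of_pos_right (⨅ n, σ n) hε)
    exact ⟨M, fun n hn h hh => (hle n h hh).trans ((hanti hn).trans hM.le)⟩
  refine ⟨⨅ n, σ n, le_ciInf hσs, hfirst, fun m N ε hε => ?_⟩
  have hK : (0 : ℝ) < Fintype.card (Fin m → κ) := by exact_mod_cast Fintype.card_pos
  have hε' : 0 < ε / (2 * Fintype.card (Fin m → κ)) := by positivity
  obtain ⟨M, hM⟩ := hfirst _ hε'
  obtain ⟨h₀, hh₀, -⟩ := hs (m + max M N)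
  obtain ⟨_, ⟨h, hh, rfl⟩, hlt⟩ := exists_lt_of_lt_csSup
    (Set.Nonempty.image (fun h : (Fin (m + max M N) → κ) → ℝ => 𝔼 x, h x) ⟨h₀, hh₀⟩)
    ((sub_lt_self _ hε').trans_le (ciInf_le hσb (m + max M N)))
  refine ⟨max M N, le_max_right _ _, h, hh, sub_le_of_expect_ge hε.le
    (fun x => hM _ (le_max_left _ _) _ (hfib _ _ h hh x)) ?_⟩
  rw [← expect_append]
  exact hlt.le

namespace Combinatorics

variable {κ ι η ζ : Type}

namespace Subspace

/-- The composition of two combinatorial subspaces. -/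
def comp_s3 (φ : Subspace η κ ι) (ψ : Subspace ζ κ η) : Subspace ζ κ ι where
  idxFun c := (φ.idxFun c).elim Sum.inl ψ.idxFun
  proper e := by
    obtain ⟨j, hj⟩ := ψ.proper e
    obtain ⟨c, hc⟩ := φ.proper j
    exact ⟨c, by simp [hc, hj]⟩

@[simp]
theorem comp_apply_s3 (φ : Subspace η κ ι) (ψ : Subspace ζ κ η) (w : ζ → κ) :
    φ.comp_s3 ψ w = φ (ψ w) := by
  funext c
  cases h : φ.idxFun c <;> simp [apply_def, comp_s3, h]

/-- The image of a combinatorial line under a combinatorial subspace. -/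
def compLine (φ : Subspace η κ ι) (l : Line κ η) : Line κ ι where
  idxFun c := (φ.idxFun c).elim some l.idxFun
  proper := by
    obtain ⟨j, hj⟩ := l.proper
    obtain ⟨c, hc⟩ := φ.proper j
    exact ⟨c, by simp [hc, hj]⟩

@[simp]
theorem compLine_apply (φ : Subspace η κ ι) (l : Line κ η) (a : κ) :
    φ.compLine l a = φ (l a) := by
  funext c
  cases h : φ.idxFun c <;> simp [apply_def, compLine, h]

/-- Extend a subspace by fixed coordinates on the right. -/
def appendRight {m n : ℕ} (φ : Subspace η κ (Fin m)) (y : Fin n → κ) :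
    Subspace η κ (Fin (m + n)) where
  idxFun := Fin.append φ.idxFun (Sum.inl ∘ y)
  proper e := by
    obtain ⟨c, hc⟩ := φ.proper e
    exact ⟨Fin.castAdd n c, by simp [hc]⟩

@[simp]
theorem appendRight_apply {m n : ℕ} (φ : Subspace η κ (Fin m)) (y : Fin n → κ) (w : η → κ) :
    φ.appendRight y w = Fin.append (φ w) y := by
  funext c
  induction c using Fin.addCases <;> simp [apply_def, appendRight]

/-- Extend a subspace by fixed coordinates on the left. -/
def appendLeft {m n : ℕ} (x : Fin m → κ) (φ : Subspace η κ (Fin n)) :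
    Subspace η κ (Fin (m + n)) where
  idxFun := Fin.append (Sum.inl ∘ x) φ.idxFun
  proper e := by
    obtain ⟨c, hc⟩ := φ.proper e
    exact ⟨Fin.natAdd m c, by simp [hc]⟩

@[simp]
theorem appendLeft_apply {m n : ℕ} (x : Fin m → κ) (φ : Subspace η κ (Fin n)) (w : η → κ) :
    φ.appendLeft x w = Fin.append x (φ w) := by
  funext c
  induction c using Fin.addCases <;> simp [apply_def, appendLeft]

/-- The product of a line and a subspace. -/
def consLine {m n k : ℕ} (l : Line κ (Fin m)) (φ : Subspace (Fin k) κ (Fin n)) :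
    Subspace (Fin (k + 1)) κ (Fin (m + n)) where
  idxFun := Fin.append (fun c => (l.idxFun c).elim (Sum.inr 0) Sum.inl)
    fun c => (φ.idxFun c).map id Fin.succ
  proper e := by
    induction e using Fin.cases with
    | zero =>
      obtain ⟨c, hc⟩ := l.proper
      exact ⟨Fin.castAdd n c, by simp [hc]⟩
    | succ e =>
      obtain ⟨c, hc⟩ := φ.proper e
      exact ⟨Fin.natAdd m c, by simp [hc]⟩

@[simp]
theorem consLine_apply {m n k : ℕ} (l : Line κ (Fin m)) (φ : Subspace (Fin k) κ (Fin n))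
    (w : Fin (k + 1) → κ) : consLine l φ w = Fin.append (l (w 0)) (φ (Fin.tail w)) := by
  funext c
  induction c using Fin.addCases with
  | left c => cases h : l.idxFun c <;> simp [apply_def, consLine, h]
  | right c => cases h : φ.idxFun c <;> simp [apply_def, consLine, h, Fin.tail]

/-- Enlarge the alphabet of a subspace. -/
def someMap (φ : Subspace η κ ι) : Subspace η (Option κ) ι where
  idxFun c := (φ.idxFun c).map some id
  proper e := by
    obtain ⟨c, hc⟩ := φ.proper e
    exact ⟨c, by simp [hc]⟩

theorem apply_injective (φ : Subspace η κ ι) : Function.Injective (φ : (η → κ) → ι → κ) := by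
  intro w w' h
  funext e
  obtain ⟨c, hc⟩ := φ.proper e
  simpa [apply_def, hc] using congrFun h c

end Subspace

/-- A set of words over `Option α` is insensitive to `i` if membership does not change when
letters `some i` and `none` are exchanged. -/
def IsInsensitive {α : Type} (i : α) (E : Set (ι → Option α)) : Prop :=
  ∀ z z' : ι → Option α, (∀ c, (z c).getD i = (z' c).getD i) → z ∈ E → z' ∈ E

namespace IsInsensitive

variable {α : Type} {i : α}

theorem mem_iff {E : Set (ι → Option α)} (hE : IsInsensitive i E) {z z' : ι → Option α}
    (h : ∀ c, (z c).getD i = (z' c).getD i) : z ∈ E ↔ z' ∈ E :=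
  ⟨hE _ _ h, hE _ _ fun c => (h c).symm⟩

theorem compl {E : Set (ι → Option α)} (hE : IsInsensitive i E) : IsInsensitive i Eᶜ :=
  fun _ _ h hz hz' => hz ((hE.mem_iff h).2 hz')

theorem preimage_subspace {E : Set (ι → Option α)} (hE : IsInsensitive i E)
    (φ : Subspace η (Option α) ι) : IsInsensitive i {w | φ w ∈ E} := by
  intro z z' h
  refine hE _ _ fun c => ?_
  cases hc : φ.idxFun c <;> simp [Subspace.apply_def, hc, h]

theorem append_right {m n : ℕ} {E : Set (Fin (m + n) → Option α)} (hE : IsInsensitive i E)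
    (x : Fin m → Option α) : IsInsensitive i {y | Fin.append x y ∈ E} := by
  intro z z' h
  refine hE _ _ fun c => ?_
  induction c using Fin.addCases <;> simp [h]

theorem append_left {m n : ℕ} {E : Set (Fin (m + n) → Option α)} (hE : IsInsensitive i E)
    (y : Fin n → Option α) : IsInsensitive i {x | Fin.append x y ∈ E} := by
  intro z z' h
  refine hE _ _ fun c => ?_
  induction c using Fin.addCases <;> simp [h]

/-- An insensitive set containing a subspace over `α` contains its extension to `Option α`. -/
theorem someMap_mem {E : Set (ι → Option α)} (hE : IsInsensitive i E) {φ : Subspace η α ι}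
    (h : ∀ w, some ∘ φ w ∈ E) (w : η → Option α) : φ.someMap w ∈ E := by
  refine hE _ _ (fun c => ?_) (h fun e => (w e).getD i)
  cases hc : φ.idxFun c <;> simp [Subspace.apply_def, Subspace.someMap, hc]

end IsInsensitive

/-- The density Hales–Jewett property: dense sets of words contain combinatorial lines. -/
def DensityHJ (α : Type) [Fintype α] : Prop :=
  ∀ δ : ℝ, 0 < δ → ∃ n, ∀ A : Set (Fin n → α), δ ≤ uniformDensity A →
    ∃ l : Line α (Fin n), ∀ a, l a ∈ A

/-- The multidimensional density Hales–Jewett theorem follows from the density Hales–Jewett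
property of the same alphabet. -/
theorem DensityHJ.exists_subspace {α : Type} [Fintype α] [Nonempty α] (h : DensityHJ α) (m : ℕ) :
    ∀ δ : ℝ, 0 < δ → ∃ n, ∀ A : Set (Fin n → α), δ ≤ uniformDensity A →
      ∃ φ : Subspace (Fin m) α (Fin n), ∀ w, φ w ∈ A := by
  classical
  induction m with
  | zero =>
    intro δ hδ
    refine ⟨0, fun A hA => ?_⟩
    obtain ⟨x, hx⟩ := exists_mem_of_uniformDensity_pos (hδ.trans_le hA)
    exact ⟨⟨Fin.elim0, fun e => e.elim0⟩, fun w => by convert hx⟩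
  | succ m ih =>
    intro δ hδ
    obtain ⟨n₁, hn₁⟩ := h (δ / 2) (by positivity)
    obtain ⟨n₂, hn₂⟩ := ih (δ / 2 / Fintype.card (Fin n₁ → Option α)) (by positivity)
    refine ⟨n₁ + n₂, fun A hA => ?_⟩
    have hG : δ / 2 ≤ uniformDensity {y : Fin n₂ → α |
        δ / 2 ≤ uniformDensity {x : Fin n₁ → α | Fin.append x y ∈ A}} := by
      refine le_uniformDensity_of_le_expect (fun y => ?_) (by positivity) ?_
      · refine (expect_mono (g := fun _ => 1) fun x => ?_).trans_eq (Fintype.expect_const _)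
        exact Set.indicator_le_self' (fun _ _ => zero_le_one) x
      · rw [mul_div_cancel₀ _ two_ne_zero]
        refine hA.trans_eq ?_
        unfold uniformDensity
        rw [expect_append, expect_expect_comm]
        rfl
    obtain ⟨w, hw⟩ := exists_popular (W := Fin n₁ → Option α) (half_pos hδ) hG
      (Q := fun w y => (∃ c, w c = none) ∧ ∀ a, Fin.append (fun c => (w c).getD a) y ∈ A)
      fun y hy => by
        obtain ⟨l, hl⟩ := hn₁ _ hy
        exact ⟨l.idxFun, l.proper, hl⟩
    obtain ⟨φ, hφ⟩ := hn₂ _ hw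
    refine ⟨Subspace.consLine ⟨w, (hφ fun _ => Classical.arbitrary α).1⟩ φ, fun v => ?_⟩
    rw [Subspace.consLine_apply]
    exact (hφ (Fin.tail v)).2 (v 0)

end Combinatorics

namespace Combinatorics

theorem uniformDensity_le_one {X : Type} [Fintype X] [Nonempty X] (A : Set X) :
    uniformDensity A ≤ 1 :=
  (expect_mono (g := fun _ => 1) fun x => Set.indicator_le_self' (fun _ _ => zero_le_one) x).trans_eq
    (Fintype.expect_const _)

theorem expect_indicator_range_nonpos {X W : Type} [Fintype X] [Fintype W] {φ : W → X}
    (hφ : Function.Injective φ) {u : X → ℝ} (h : 𝔼 w, u (φ w) ≤ 0) :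
    𝔼 x, (Set.range φ).indicator u x ≤ 0 := by
  classical
  have hsum : ∑ w, u (φ w) ≤ 0 := by
    rw [← Fintype.card_mul_expect]
    exact mul_nonpos_of_nonneg_of_nonpos (Nat.cast_nonneg _) h
  rw [Fintype.expect_eq_sum_div_card]
  refine div_nonpos_of_nonpos_of_nonneg ?_ (Nat.cast_nonneg _)
  calc ∑ x, (Set.range φ).indicator u x
      = ∑ x ∈ Finset.univ.image φ, (Set.range φ).indicator u x := by
        refine (Finset.sum_subset (Finset.subset_univ _) fun x _ hx => ?_).symm
        exact Set.indicator_of_notMem (by simpa using hx) _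
    _ = ∑ w, u (φ w) := by
        rw [Finset.sum_image hφ.injOn]
        exact Finset.sum_congr rfl fun w _ => Set.indicator_of_mem (Set.mem_range_self w) _
    _ ≤ 0 := hsum

/-- A choice, for every set of words containing an `m`-dimensional subspace, of the point set of
such a subspace. -/
theorem exists_subspace_choice (m a : ℕ) (κ : Type) :
    ∃ V : Set (Fin a → κ) → Set (Fin a → κ), (∀ F, V F ⊆ F) ∧
      ∀ F, (V F = ∅ ∨ ∃ φ : Subspace (Fin m) κ (Fin a), V F = Set.range φ) ∧
        ((∃ φ : Subspace (Fin m) κ (Fin a), ∀ w, φ w ∈ F) →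
          ∃ φ : Subspace (Fin m) κ (Fin a), V F = Set.range φ) := by
  have key : ∀ F : Set (Fin a → κ), ∃ U ⊆ F,
      (U = ∅ ∨ ∃ φ : Subspace (Fin m) κ (Fin a), U = Set.range φ) ∧
        ((∃ φ : Subspace (Fin m) κ (Fin a), ∀ w, φ w ∈ F) →
          ∃ φ : Subspace (Fin m) κ (Fin a), U = Set.range φ) := by
    intro F
    by_cases hF : ∃ φ : Subspace (Fin m) κ (Fin a), ∀ w, φ w ∈ F
    · obtain ⟨φ, hφ⟩ := hF
      exact ⟨Set.range φ, Set.range_subset_iff.2 hφ, Or.inr ⟨φ, rfl⟩, fun _ => ⟨φ, rfl⟩⟩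
    · exact ⟨∅, Set.empty_subset _, Or.inl rfl, fun h => absurd h hF⟩
  choose V hV using key
  exact ⟨V, fun F => (hV F).1, fun F => (hV F).2⟩

variable {α : Type} [Fintype α]

/-- A function bounded by one with nonpositive average on all `m`-dimensional subspaces has
almost nonpositive average on every insensitive set. -/
theorem DensityHJ.expect_indicator_le_of_isInsensitive (hα : DensityHJ α) (i : α) (m : ℕ) {ε : ℝ}
    (hε : 0 < ε) :
    ∃ n, ∀ f : (Fin n → Option α) → ℝ, (∀ x, f x ≤ 1) →
      (∀ φ : Subspace (Fin m) (Option α) (Fin n), 𝔼 w, f (φ w) ≤ 0) →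
      ∀ E, IsInsensitive i E → 𝔼 x, E.indicator f x ≤ ε := by
  classical
  have : Nonempty α := ⟨i⟩
  by_contra! hcon
  let C : ∀ n, Set ((Fin n → Option α) → ℝ) := fun n => {h |
    ∃ (f : (Fin n → Option α) → ℝ) (E : Set (Fin n → Option α)), (∀ x, f x ≤ 1) ∧
    (∀ φ : Subspace (Fin m) (Option α) (Fin n), 𝔼 w, f (φ w) ≤ 0) ∧ IsInsensitive i E ∧
    h = E.indicator fun x => f x - ε / 2}
  obtain ⟨t, hst, hM, hext⟩ := exists_extremal C
    (by
      rintro n _ ⟨f, E, hf, -, -, rfl⟩ x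
      refine Set.indicator_apply_le' (fun _ => ?_) fun _ => zero_le_one
      linarith [hf x])
    (by
      rintro k n _ ⟨f, E, hf, hφ, hE, rfl⟩ x
      exact ⟨fun y => f (Fin.append x y), {y | Fin.append x y ∈ E}, fun y => hf _,
        fun φ => by simpa using hφ (φ.appendLeft x), hE.append_right x, rfl⟩)
    (s := ε / 2)
    (by
      intro n
      obtain ⟨f, hf, hφ, E, hE, hlt⟩ := hcon n
      refine ⟨_, ⟨f, E, hf, hφ, hE, rfl⟩, ?_⟩
      have : 𝔼 x, (E.indicator f x - ε / 2) ≤ 𝔼 x, E.indicator (fun x => f x - ε / 2) x :=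
        expect_mono fun x => by
          by_cases hx : x ∈ E
          · simp [hx]
          · simpa [hx] using (half_pos hε).le
      rw [Finset.expect_sub_distrib, Fintype.expect_const] at this
      linarith)
  have ht : 0 < t := by linarith
  obtain ⟨a, ha⟩ := hα.exists_subspace m (t / 4) (by positivity)
  set K : ℝ := (Fintype.card (Fin a → Option α) : ℝ) with hK
  have hK0 : 0 < K := by rw [hK]; exact_mod_cast Fintype.card_pos
  set ε₁ := min (t / 2) (ε / 2 * (t / 4 * K⁻¹) / 4) with hε₁
  have hε₁0 : 0 < ε₁ := by positivity
  obtain ⟨M, hM⟩ := hM ε₁ hε₁0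
  obtain ⟨n, hn, _, ⟨f, E, hf, hφ, hE, rfl⟩, hfibre⟩ := hext a M ε₁ hε₁0
  obtain ⟨V, hVsub, hV⟩ := exists_subspace_choice m a (Option α)
  set slice : (Fin n → Option α) → Set (Fin a → Option α) := fun y => {x | Fin.append x y ∈ E}
  set B : Set (Fin (a + n) → Option α) :=
    {z | (fun c => z (Fin.castAdd n c)) ∈ V (slice fun c => z (Fin.natAdd a c))} with hB
  have hmemB : ∀ x y, Fin.append x y ∈ B ↔ x ∈ V (slice y) := fun x y => by simp [hB]
  set g : (Fin (a + n) → Option α) → ℝ := fun z => f z - ε / 2 with hg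
  have hsplit : 𝔼 z, E.indicator g z ≤ 𝔼 z, (E \ B).indicator g z + 𝔼 z, B.indicator g z := by
    rw [← Finset.expect_add_distrib]
    refine expect_mono fun z => ?_
    by_cases hzB : z ∈ B
    · have hzE : z ∈ E := by
        have := hVsub _ hzB
        simpa only [slice, Set.mem_ofPred_eq, Fin.append_castAdd_natAdd] using this
      simp [hzB, hzE]
    · by_cases hzE : z ∈ E <;> simp [hzB, hzE]
  have hlower : t - ε₁ ≤ 𝔼 z, E.indicator g z := by
    rw [expect_append]
    refine le_trans ?_ (expect_mono hfibre)
    rw [Fintype.expect_const]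
  have hupper : 𝔼 z, (E \ B).indicator g z ≤ t + ε₁ := by
    rw [expect_append]
    refine (expect_mono (g := fun _ => t + ε₁) fun x => ?_).trans_eq (Fintype.expect_const _)
    refine hM n hn _ ⟨fun y => f (Fin.append x y), {y | Fin.append x y ∈ E \ B}, fun y => hf _,
      fun φ => by simpa using hφ (φ.appendLeft x), ?_, rfl⟩
    rintro y y' hyy' ⟨hyE, hyB⟩
    refine ⟨(hE.append_right x) _ _ hyy' hyE, fun hy'B => hyB ?_⟩
    rw [hmemB] at hy'B ⊢
    have : slice y = slice y' := Set.ext fun x' => (hE.append_right x').mem_iff hyy'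
    rwa [this]
  set G : Set (Fin n → Option α) :=
    {y | t / 4 ≤ uniformDensity {x : Fin a → α | Fin.append (some ∘ x) y ∈ E}} with hG
  have hGdens : t / 4 ≤ uniformDensity G := by
    refine le_uniformDensity_of_le_expect (fun y => uniformDensity_le_one _) (by positivity) ?_
    unfold uniformDensity
    rw [expect_expect_comm]
    refine le_trans ?_ (expect_mono fun x => (hfibre (some ∘ x)).trans
      (expect_mono (g := fun y => E.indicator 1 (Fin.append (some ∘ x) y)) fun y => ?_))
    · rw [Fintype.expect_const]
      linarith [min_le_left (t / 2) (ε / 2 * (t / 4 * K⁻¹) / 4)]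
    · refine Set.indicator_le_indicator ?_
      simp only [Pi.one_apply, hg]
      linarith [hf (Fin.append (some ∘ x) y)]
  have hremoved : 𝔼 z, B.indicator g z ≤ -(ε / 2 * (t / 4 * K⁻¹)) := by
    rw [expect_append, expect_expect_comm]
    have hy : ∀ y, 𝔼 x, B.indicator g (Fin.append x y) ≤ -(ε / 2 * K⁻¹) * G.indicator 1 y := by
      intro y
      have hrw : 𝔼 x, B.indicator g (Fin.append x y) =
          𝔼 x, (V (slice y)).indicator (fun x => f (Fin.append x y)) x
            - ε / 2 * uniformDensity (V (slice y)) := by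
        unfold uniformDensity
        rw [Finset.mul_expect, ← Finset.expect_sub_distrib]
        refine Finset.expect_congr rfl fun x _ => ?_
        by_cases hx : x ∈ V (slice y)
        · simp [hx, (hmemB x y).2 hx, hg]
        · simp [hx, mt (hmemB x y).1 hx]
      rw [hrw]
      have hrange : ∀ φ : Subspace (Fin m) (Option α) (Fin a),
          𝔼 x, (Set.range φ).indicator (fun x => f (Fin.append x y)) x ≤ 0 := fun φ =>
        expect_indicator_range_nonpos φ.apply_injective (by simpa using hφ (φ.appendRight y))
      by_cases hyG : y ∈ G
      · obtain ⟨ψ, hψ⟩ := ha _ hyG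
        obtain ⟨φ, hφV⟩ := (hV (slice y)).2 ⟨ψ.someMap, (hE.append_left y).someMap_mem hψ⟩
        have h1 := hrange φ
        have h2 : K⁻¹ ≤ uniformDensity (V (slice y)) :=
          inv_card_le_uniformDensity (x := φ fun _ => none) (hφV ▸ ⟨_, rfl⟩)
        have h3 := mul_le_mul_of_nonneg_left h2 (half_pos hε).le
        rw [← hφV] at h1
        simp only [hyG, Set.indicator_of_mem, Pi.one_apply]
        linarith
      · have h2 := mul_nonneg (half_pos hε).le (uniformDensity_nonneg (V (slice y)))
        have h1 : 𝔼 x, (V (slice y)).indicator (fun x => f (Fin.append x y)) x ≤ 0 := by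
          rcases (hV (slice y)).1 with h | ⟨φ, h⟩
          · simp [h]
          · rw [h]; exact hrange φ
        simp only [hyG, not_false_eq_true, Set.indicator_of_notMem]
        linarith
    refine (expect_mono hy).trans ?_
    rw [← Finset.mul_expect]
    have : ε / 2 * K⁻¹ * (t / 4) ≤ ε / 2 * K⁻¹ * uniformDensity G := by gcongr
    unfold uniformDensity at this
    linarith
  have h1 : ε₁ ≤ ε / 2 * (t / 4 * K⁻¹) / 4 := min_le_right _ _
  have h2 : 0 < ε / 2 * (t / 4 * K⁻¹) := by positivity
  linarith

/-- The version of `DensityHJ.expect_indicator_le_of_isInsensitive` for intersections of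
insensitive sets. -/
theorem DensityHJ.expect_indicator_iInter_le (hα : DensityHJ α) (m : ℕ) (s : Finset α) :
    ∀ ε : ℝ, 0 < ε → ∃ n, ∀ f : (Fin n → Option α) → ℝ, (∀ x, f x ≤ 1) →
      (∀ φ : Subspace (Fin m) (Option α) (Fin n), 𝔼 w, f (φ w) ≤ 0) →
      ∀ E : α → Set (Fin n → Option α), (∀ i, IsInsensitive i (E i)) →
        𝔼 x, (⋂ i ∈ s, E i).indicator f x ≤ ε := by
  classical
  induction s using Finset.induction_on with
  | empty =>
    intro ε hε
    refine ⟨m, fun f _ hφ E _ => ?_⟩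
    have := hφ default
    refine le_trans ?_ (this.trans hε.le)
    simp only [Finset.notMem_empty, Set.iInter_of_empty, Set.iInter_univ, Set.indicator_univ]
    exact le_of_eq rfl
  | insert j s _ ih =>
    intro ε hε
    obtain ⟨n₁, hn₁⟩ := ih (ε / 2) (half_pos hε)
    obtain ⟨n, hn⟩ := hα.expect_indicator_le_of_isInsensitive j n₁ (half_pos hε)
    refine ⟨n, fun f hf hφ E hE => ?_⟩
    have key := hn (fun x => (⋂ i ∈ s, E i).indicator f x - ε / 2)
      (fun x => by
        have : (⋂ i ∈ s, E i).indicator f x ≤ 1 :=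
          Set.indicator_apply_le' (fun _ => hf x) fun _ => zero_le_one
        linarith)
      (fun φ => by
        rw [Finset.expect_sub_distrib, Fintype.expect_const, sub_nonpos]
        refine le_trans (le_of_eq ?_) (hn₁ (fun w => f (φ w)) (fun w => hf _)
          (fun ψ => by simpa using hφ (φ.comp_s3 ψ)) (fun i => {w | φ w ∈ E i})
          fun i => (hE i).preimage_subspace φ)
        refine Finset.expect_congr rfl fun w _ => ?_
        by_cases hw : φ w ∈ ⋂ i ∈ s, E i
        · rw [Set.indicator_of_mem hw, Set.indicator_of_mem (by simpa using hw)]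
        · rw [Set.indicator_of_notMem hw, Set.indicator_of_notMem (by simpa using hw)])
      (E j) (hE j)
    have : 𝔼 x, (⋂ i ∈ insert j s, E i).indicator f x ≤
        𝔼 x, ((E j).indicator (fun x => (⋂ i ∈ s, E i).indicator f x - ε / 2) x + ε / 2) := by
      refine expect_mono fun x => ?_
      rw [Finset.set_biInter_insert, ← Set.indicator_indicator]
      by_cases hx : x ∈ E j
      · simp [hx]
      · simpa [hx] using (half_pos hε).le
    rw [Finset.expect_add_distrib, Fintype.expect_const] at this
    linarith

theorem expect_indicator_compl_iInter_le {n : ℕ} {ε : ℝ} {f : (Fin n → Option α) → ℝ}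
    (h : ∀ E : α → Set (Fin n → Option α), (∀ i, IsInsensitive i (E i)) →
      𝔼 x, (⋂ i, E i).indicator f x ≤ ε)
    {D : α → Set (Fin n → Option α)} (hD : ∀ i, IsInsensitive i (D i)) :
    𝔼 x, (⋂ i, D i)ᶜ.indicator f x ≤ Fintype.card α * ε := by
  classical
  suffices hs : ∀ s : Finset α, 𝔼 x, (⋂ i ∈ s, D i)ᶜ.indicator f x ≤ s.card * ε by
    simpa using hs Finset.univ
  intro s
  induction s using Finset.induction_on with
  | empty => simp
  | insert j s hj ih =>
    have hnew := h (fun i => if i = j then (D j)ᶜ else if i ∈ s then D i else Set.univ) fun i => by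
      by_cases hi : i = j
      · subst hi; simpa using (hD i).compl
      · by_cases his : i ∈ s
        · simpa [hi, his] using hD i
        · simp [hi, his, IsInsensitive]
    have hset : (⋂ i, if i = j then (D j)ᶜ else if i ∈ s then D i else Set.univ) =
        (D j)ᶜ ∩ ⋂ i ∈ s, D i := by
      ext x
      rw [Set.mem_iInter, Set.mem_inter_iff, Set.mem_iInter₂]
      constructor
      · refine fun hx => ⟨by simpa using hx j, fun i hi => ?_⟩
        have hij : i ≠ j := fun h => hj (h ▸ hi)
        simpa [hij, hi] using hx i
      · rintro ⟨hxj, hxs⟩ i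
        by_cases hi : i = j
        · simpa [hi] using hxj
        · by_cases his : i ∈ s
          · simpa [hi, his] using hxs i his
          · simp [hi, his]
    rw [hset] at hnew
    have hsum : 𝔼 x, (⋂ i ∈ insert j s, D i)ᶜ.indicator f x =
        𝔼 x, (⋂ i ∈ s, D i)ᶜ.indicator f x + 𝔼 x, ((D j)ᶜ ∩ ⋂ i ∈ s, D i).indicator f x := by
      rw [← Finset.expect_add_distrib, Finset.set_biInter_insert]
      refine Finset.expect_congr rfl fun x _ => ?_
      generalize (⋂ i ∈ s, D i) = U
      by_cases h1 : x ∈ D j <;> by_cases h2 : x ∈ U <;> simp [h1, h2]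
    rw [hsum, Finset.card_insert_of_notMem hj]
    push_cast
    linarith

end Combinatorics

namespace Combinatorics

section Blend

variable {α : Type} {m d D : ℕ} (e : Fin m × Option (Fin d) ≃ Fin D)

/-- The word consisting of `m` blocks, the `j`-th of which is `u j` with all letters `none`
replaced by `w j`, followed by `w j` itself. -/
def blend (u : Fin m → Fin d → Option α) (w : Fin m → Option α) : Fin D → Option α := fun c =>
  ((e.symm c).2.bind (u (e.symm c).1)).or (w (e.symm c).1)

/-- The subspace of blends in which only the block `j` varies. -/
def blendSubspace (u : Fin m → Fin d → Option α) (w : Fin m → Option α) (j : Fin m) :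
    Subspace (Fin d) (Option α) (Fin D) where
  idxFun c := if (e.symm c).1 = j then (e.symm c).2.elim (Sum.inl none) Sum.inr else
    Sum.inl (blend e u w c)
  proper o := ⟨e (j, some o), by simp⟩

theorem blendSubspace_apply (u : Fin m → Fin d → Option α) {w : Fin m → Option α} {j : Fin m}
    (hj : w j = none) (z : Fin d → Option α) :
    blendSubspace e u w j z = blend e (Function.update u j z) w := by
  funext c
  obtain ⟨⟨i, o⟩, rfl⟩ := e.surjective c
  by_cases hi : i = j
  · subst hi
    cases o <;> simp [Subspace.apply_def, blendSubspace, blend, hj]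
  · simp [Subspace.apply_def, blendSubspace, blend, hi]

/-- The line whose wildcards are the letters `none` of a blend. -/
def blendLine {n : ℕ} (u : Fin m → Fin d → Option α) (w : Fin m → Option α)
    (hw : ∃ j, w j = none) (y : Fin n → Option α) : Line (Option α) (Fin (D + n)) where
  idxFun := Fin.append (fun c => (blend e u w c).map some) (some ∘ y)
  proper := by
    obtain ⟨j, hj⟩ := hw
    exact ⟨Fin.castAdd n (e (j, none)), by simp [blend, hj]⟩

theorem blendLine_none {n : ℕ} (u : Fin m → Fin d → Option α) (w : Fin m → Option α)
    (hw : ∃ j, w j = none) (y : Fin n → Option α) :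
    blendLine e u w hw y none = Fin.append (blend e u w) y := by
  funext c
  induction c using Fin.addCases with
  | left c => cases h : blend e u w c <;> simp [blendLine, Line.coe_apply, h]
  | right c => simp [blendLine, Line.coe_apply]

theorem blendLine_some {n : ℕ} (u : Fin m → Fin d → Option α) (w : Fin m → Option α)
    (hw : ∃ j, w j = none) (y : Fin n → Option α) (a : α) :
    blendLine e u w hw y (some a) = Fin.append (blend e u fun j => some ((w j).getD a)) y := by
  funext c
  induction c using Fin.addCases with
  | left c =>
    obtain ⟨⟨i, o⟩, rfl⟩ := e.surjective c
    cases o with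
    | none => cases h : w i <;> simp [blendLine, Line.coe_apply, blend, h]
    | some o =>
      cases h : w i <;> cases h' : u i o <;> simp [blendLine, Line.coe_apply, blend, h, h']
  | right c => simp [blendLine, Line.coe_apply]

theorem isInsensitive_blend {n : ℕ} (u : Fin m → Fin d → Option α) {w : Fin m → Option α}
    {j : Fin m} (hj : w j = none) (y : Fin n → Option α) (A : Set (Fin (D + n) → Option α))
    (a : α) :
    IsInsensitive a {z | Fin.append
      (blend e (Function.update u j z) fun i => some ((w i).getD a)) y ∈ A} := by
  intro z z' h hz
  have : blend e (Function.update u j z) (fun i => some ((w i).getD a)) =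
      blend e (Function.update u j z') fun i => some ((w i).getD a) := by
    funext c
    obtain ⟨⟨i, o⟩, rfl⟩ := e.surjective c
    cases o with
    | none => simp [blend]
    | some o =>
      by_cases hi : i = j
      · subst hi
        have := h o
        cases h1 : z o <;> cases h2 : z' o <;> simp_all [blend]
      · simp [blend, hi]
  rwa [Set.mem_ofPred_eq, ← this]

end Blend

variable {α : Type} [Fintype α]

/-- A set dense on every fibre contains, for some fixed word `w` with wildcards, the blends of the
line of `w` over `α` with a positive proportion of all pairs. -/
theorem exists_popular_blend [Nonempty α] {m d D n : ℕ} (e : Fin m × Option (Fin d) ≃ Fin D)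
    {t : ℝ} (ht : 0 < t)
    (hm : ∀ A : Set (Fin m → α), t / 4 ≤ uniformDensity A → ∃ l : Line α (Fin m), ∀ a, l a ∈ A)
    {A : Set (Fin (D + n) → Option α)}
    (hA : ∀ x, t / 2 ≤ 𝔼 y, A.indicator (fun _ => (1 : ℝ)) (Fin.append x y)) :
    ∃ w : Fin m → Option α, (∃ j, w j = none) ∧
      t / 4 / Fintype.card (Fin m → Option α) ≤
        uniformDensity {p : (Fin m → Fin d → Option α) × (Fin n → Option α) |
          ∀ a, Fin.append (blend e p.1 fun j => some ((w j).getD a)) p.2 ∈ A} := by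
  classical
  have hG : t / 4 ≤ uniformDensity {p : (Fin m → Fin d → Option α) × (Fin n → Option α) |
      t / 4 ≤ uniformDensity {x : Fin m → α | Fin.append (blend e p.1 (some ∘ x)) p.2 ∈ A}} := by
    refine le_uniformDensity_of_le_expect (fun _ => uniformDensity_le_one _) (by positivity) ?_
    unfold uniformDensity
    rw [expect_expect_comm]
    have hx : ∀ x : Fin m → α, t / 2 ≤ 𝔼 p : (Fin m → Fin d → Option α) × (Fin n → Option α),
        Set.indicator {x : Fin m → α | Fin.append (blend e p.1 (some ∘ x)) p.2 ∈ A} 1 x := by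
      intro x
      rw [expect_prod]
      refine le_trans ?_ (expect_mono fun u => hA (blend e u (some ∘ x)))
      rw [Fintype.expect_const]
    refine le_trans ?_ (expect_mono hx)
    rw [Fintype.expect_const]
    linarith
  obtain ⟨w, hw⟩ := exists_popular (W := Fin m → Option α) (by positivity) hG
    (Q := fun w p => (∃ j, w j = none) ∧
      ∀ a, Fin.append (blend e p.1 fun j => some ((w j).getD a)) p.2 ∈ A)
    fun p hp => by
      obtain ⟨l, hl⟩ := hm _ hp
      exact ⟨l.idxFun, l.proper, hl⟩
  have hcard : (0 : ℝ) < Fintype.card (Fin m → Option α) := by exact_mod_cast Fintype.card_pos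
  obtain ⟨p, hp⟩ := exists_mem_of_uniformDensity_pos (lt_of_lt_of_le (by positivity) hw)
  exact ⟨w, hp.1, by simpa only [hp.1, true_and] using hw⟩

theorem DensityHJ.option_of_nonempty [Nonempty α] (hα : DensityHJ α) : DensityHJ (Option α) := by
  classical
  by_contra hcon
  simp only [DensityHJ, not_forall, not_exists] at hcon
  obtain ⟨δ, hδ, hcon⟩ := hcon
  let C : ∀ n, Set ((Fin n → Option α) → ℝ) := fun n =>
    {h | ∃ A : Set (Fin n → Option α), (∀ l : Line (Option α) (Fin n), ∃ a, l a ∉ A) ∧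
      h = A.indicator fun _ => 1}
  obtain ⟨t, hδt, hM, hext⟩ := exists_extremal C
    (by
      rintro n _ ⟨A, -, rfl⟩ x
      exact Set.indicator_le_self' (fun _ _ => zero_le_one) x)
    (by
      rintro m n _ ⟨A, hA, rfl⟩ x
      refine ⟨{y | Fin.append x y ∈ A}, fun l => ?_, rfl⟩
      obtain ⟨a, ha⟩ := hA (((default : Subspace (Fin n) (Option α) (Fin n)).appendLeft x).compLine l)
      rw [Subspace.compLine_apply, Subspace.appendLeft_apply] at ha
      exact ⟨a, ha⟩)
    (s := δ)
    (by
      intro n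
      obtain ⟨A, hA, hl⟩ := hcon n
      exact ⟨_, ⟨A, fun l => by simpa using hl l, rfl⟩, hA⟩)
  have ht : 0 < t := hδ.trans_le hδt
  obtain ⟨m, hm⟩ := hα (t / 4) (by positivity)
  set θ : ℝ := t / 4 / Fintype.card (Fin m → Option α) with hθ
  have hθ0 : 0 < θ := by
    have : (0 : ℝ) < Fintype.card (Fin m → Option α) := by exact_mod_cast Fintype.card_pos
    positivity
  set γ : ℝ := t * θ / 4 with hγ
  have hγ0 : 0 < γ := by positivity
  obtain ⟨M, hM⟩ := hM γ hγ0
  have hk : (0 : ℝ) < Fintype.card α := by exact_mod_cast Fintype.card_pos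
  obtain ⟨d, hd⟩ := hα.expect_indicator_iInter_le M Finset.univ (γ / Fintype.card α) (by positivity)
  let e := Fintype.equivFin (Fin m × Option (Fin d))
  obtain ⟨n, -, _, ⟨A, hA, rfl⟩, hfibre⟩ :=
    hext (Fintype.card (Fin m × Option (Fin d))) 0 (min (t / 2) (γ / 2)) (by positivity)
  obtain ⟨w, ⟨j, hj⟩, hw⟩ := exists_popular_blend e ht hm (A := A) fun x => by
    linarith [hfibre x, min_le_left (t / 2) (γ / 2)]
  set D : (Fin m → Fin d → Option α) → (Fin n → Option α) → α → Set (Fin d → Option α) :=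
    fun u y a => {z | Fin.append
      (blend e (Function.update u j z) fun i => some ((w i).getD a)) y ∈ A} with hD
  have hlocal : ∀ u y,
      𝔼 z, A.indicator (fun _ => (1 : ℝ)) (Fin.append (blend e (Function.update u j z) w) y) - (t + γ) ≤
        γ - (t + γ) * uniformDensity (⋂ a, D u y a) := by
    intro u y
    set Φ := (blendSubspace e u w j).appendRight y with hΦ
    have hΦa : ∀ z, Φ z = Fin.append (blend e (Function.update u j z) w) y := fun z => by
      rw [hΦ, Subspace.appendRight_apply, blendSubspace_apply e u hj]
    set f : (Fin d → Option α) → ℝ := fun z => A.indicator (fun _ => (1 : ℝ)) (Φ z) - (t + γ) with hf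
    have hf1 : ∀ z, f z ≤ 1 := fun z => by
      have : A.indicator (fun _ => (1 : ℝ)) (Φ z) ≤ 1 :=
        Set.indicator_le_self' (fun _ _ => zero_le_one) _
      simp only [hf]
      linarith
    have hfφ : ∀ φ : Subspace (Fin M) (Option α) (Fin d), 𝔼 v, f (φ v) ≤ 0 := fun φ => by
      simp only [hf]
      rw [Finset.expect_sub_distrib, Fintype.expect_const, sub_nonpos]
      refine hM M le_rfl _ ⟨{v | Φ (φ v) ∈ A}, fun l => ?_, rfl⟩
      obtain ⟨a, ha⟩ := hA ((Φ.comp_s3 φ).compLine l)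
      exact ⟨a, by simpa using ha⟩
    have hcompl := expect_indicator_compl_iInter_le (f := f) (ε := γ / Fintype.card α)
      (fun E hE => by simpa using hd f hf1 hfφ E hE)
      (D := D u y) fun a => isInsensitive_blend e u hj y A a
    rw [mul_div_cancel₀ _ hk.ne'] at hcompl
    have hinter : ∀ z ∈ ⋂ a, D u y a, f z = -(t + γ) := by
      intro z hz
      rw [Set.mem_iInter] at hz
      have : Φ z ∉ A := fun hmem => by
        obtain ⟨a, ha⟩ := hA (blendLine e (Function.update u j z) w ⟨j, hj⟩ y)
        cases a with
        | none => exact ha (by rwa [blendLine_none, ← hΦa])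
        | some a => exact ha (by rw [blendLine_some]; exact hz a)
      simp [hf, this]
    have hsplit : 𝔼 z, f z = 𝔼 z, (⋂ a, D u y a)ᶜ.indicator f z -
        (t + γ) * uniformDensity (⋂ a, D u y a) := by
      unfold uniformDensity
      rw [Finset.mul_expect, ← Finset.expect_sub_distrib]
      refine Finset.expect_congr rfl fun z _ => ?_
      by_cases hz : z ∈ ⋂ a, D u y a
      · rw [Set.indicator_of_notMem (by simpa using hz), Set.indicator_of_mem hz, hinter z hz]
        simp
      · rw [Set.indicator_of_mem (by exact hz), Set.indicator_of_notMem hz]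
        simp
    simp only [← hΦa]
    have hEf : 𝔼 z, f z = 𝔼 z, A.indicator (fun _ => (1 : ℝ)) (Φ z) - (t + γ) := by
      simp only [hf]
      rw [Finset.expect_sub_distrib, Fintype.expect_const]
    linarith
  have hav : 𝔼 u, 𝔼 y, (𝔼 z, A.indicator (fun _ => (1 : ℝ))
      (Fin.append (blend e (Function.update u j z) w) y) - (t + γ)) ≤
      𝔼 u, 𝔼 y, (γ - (t + γ) * uniformDensity (⋂ a, D u y a)) :=
    expect_mono fun u => expect_mono fun y => hlocal u y
  simp only [Finset.expect_sub_distrib, Fintype.expect_const, ← Finset.mul_expect] at hav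
  have hleft : t - γ / 2 ≤ 𝔼 u, 𝔼 y, 𝔼 z, A.indicator (fun _ => (1 : ℝ))
      (Fin.append (blend e (Function.update u j z) w) y) := by
    have h1 : ∀ u z, t - γ / 2 ≤ 𝔼 y, A.indicator (fun _ => (1 : ℝ))
        (Fin.append (blend e (Function.update u j z) w) y) := fun u z => by
      linarith [hfibre (blend e (Function.update u j z) w), min_le_right (t / 2) (γ / 2)]
    have h2 : ∀ u, t - γ / 2 ≤ 𝔼 y, 𝔼 z, A.indicator (fun _ => (1 : ℝ))
        (Fin.append (blend e (Function.update u j z) w) y) := fun u => by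
      rw [expect_expect_comm]
      exact (Fintype.expect_const _).symm.trans_le (expect_mono (h1 u))
    exact (Fintype.expect_const _).symm.trans_le (expect_mono h2)
  have hright : θ ≤ 𝔼 u, 𝔼 y, uniformDensity (⋂ a, D u y a) := by
    refine hw.trans_eq ?_
    unfold uniformDensity
    rw [expect_prod, ← expect_update j]
    refine Finset.expect_congr rfl fun u _ => ?_
    rw [expect_expect_comm]
    refine Finset.expect_congr rfl fun y _ => Finset.expect_congr rfl fun z _ => ?_
    simp [Set.indicator_apply, hD]
  have := mul_le_mul_of_nonneg_left hright (add_pos ht hγ0).le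
  nlinarith [mul_pos hγ0 hθ0]

/-- The alphabet of size one. -/
theorem DensityHJ.option_of_isEmpty [IsEmpty α] : DensityHJ (Option α) := by
  intro δ hδ
  refine ⟨1, fun A hA => ?_⟩
  obtain ⟨x, hx⟩ := exists_mem_of_uniformDensity_pos (hδ.trans_le hA)
  exact ⟨⟨fun _ => none, 0, rfl⟩, fun a => by
    convert hx
    exact Subsingleton.elim _ _⟩

theorem DensityHJ.of_equiv {β : Type} [Fintype β] (e : α ≃ β) (h : DensityHJ α) :
    DensityHJ β := by
  intro δ hδ
  obtain ⟨n, hn⟩ := h δ hδ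
  refine ⟨n, fun A hA => ?_⟩
  have hdens : uniformDensity {x | e ∘ x ∈ A} = uniformDensity A :=
    Fintype.expect_equiv ((Equiv.refl (Fin n)).arrowCongr e) _ _ fun _ => rfl
  obtain ⟨l, hl⟩ := hn {x | e ∘ x ∈ A} (hA.trans_eq hdens.symm)
  refine ⟨l.map e, fun b => ?_⟩
  rw [← e.apply_symm_apply b, Line.map_apply]
  exact hl _

/-- The **density Hales–Jewett theorem**. -/
theorem densityHJ [Nonempty α] : DensityHJ α := by
  suffices h : ∀ (β : Type) [Fintype β], Nonempty β → DensityHJ β from h α ‹_›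
  intro β _
  refine Fintype.induction_empty_option (P := fun β _ => Nonempty β → DensityHJ β) ?_ ?_ ?_ β
  · intro β γ _ e ih _
    let _ := Fintype.ofEquiv γ e.symm
    exact (ih e.nonempty).of_equiv e
  · exact fun h => absurd h (by simp)
  · intro β _ ih _
    cases isEmpty_or_nonempty β with
    | inl _ => exact DensityHJ.option_of_isEmpty
    | inr h => exact (ih h).option_of_nonempty

end Combinatorics

namespace Combinatorics

theorem exists_uniformDensity_le_translate {X G : Type} [Fintype X] [Nonempty X] [AddCommGroup G]
    [Fintype G] (s : X → G) (S : Set G) :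
    ∃ b, uniformDensity S ≤ uniformDensity {x | b + s x ∈ S} := by
  have h1 : ∀ x, 𝔼 b, S.indicator (fun _ => (1 : ℝ)) (b + s x) = uniformDensity S := fun x =>
    Fintype.expect_equiv (Equiv.addRight (s x)) _ _ fun _ => rfl
  have h2 : 𝔼 b, uniformDensity {x | b + s x ∈ S} = uniformDensity S := by
    rw [← Fintype.expect_const (ι := X) (uniformDensity S)]
    exact (expect_expect_comm _).trans (Finset.expect_congr rfl fun x _ => h1 x)
  obtain ⟨b, -, hb⟩ := Finset.exists_le_of_le_expect Finset.univ_nonempty h2.symm.le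
  exact ⟨b, hb⟩

/-- A density version of Gallai's theorem, deduced from density Hales–Jewett. -/
theorem exists_dilate_subset {α : Type} [Fintype α] [Nonempty α] {δ : ℝ} (hδ : 0 < δ) :
    ∃ N : ℕ, ∀ (G : Type) [AddCommGroup G] [Fintype G] (v : α → G) (S : Set G),
      δ ≤ uniformDensity S → ∃ (b : G) (d : ℕ), 0 < d ∧ d ≤ N ∧ ∀ a, b + d • v a ∈ S := by
  classical
  obtain ⟨N, hN⟩ := densityHJ (α := α) δ hδ
  refine ⟨N, fun G _ _ v S hS => ?_⟩
  obtain ⟨b, hb⟩ := exists_uniformDensity_le_translate (fun w : Fin N → α => ∑ c, v (w c)) S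
  obtain ⟨l, hl⟩ := hN _ (hS.trans hb)
  refine ⟨b + ∑ c, (l.idxFun c).elim 0 v, (Finset.univ.filter fun c => l.idxFun c = none).card,
    ?_, ?_, fun a => ?_⟩
  · obtain ⟨c, hc⟩ := l.proper
    exact Finset.card_pos.2 ⟨c, by simpa using hc⟩
  · exact (Finset.card_le_univ _).trans_eq (Fintype.card_fin N)
  · have hsum : ∑ c, v (l a c) = ∑ c, (l.idxFun c).elim 0 v +
        (Finset.univ.filter fun c => l.idxFun c = none).card • v a := by
      rw [← Finset.sum_const, Finset.sum_filter, ← Finset.sum_add_distrib]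
      refine Finset.sum_congr rfl fun c _ => ?_
      cases h : l.idxFun c <;> simp [Line.coe_apply, h]
    rw [add_assoc, ← hsum]
    exact hl a

end Combinatorics

/-- A set attaining the minimum in the definition of `gmin`. -/
theorem exists_gP_eq_gmin (k : ℕ) : ∃ P : Finset (ℤ × ℤ), P.card = k ∧ gP P = gmin k := by
  obtain ⟨P, hP⟩ := Infinite.exists_subset_card_eq (ℤ × ℤ) k
  exact Nat.sInf_mem (s := {m | ∃ P : Finset (ℤ × ℤ), P.card = k ∧ gP P = m}) ⟨_, P, hP, rfl⟩

/-- Small dilates of distinct integers in a bounded range remain distinct modulo `n`. -/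
theorem eq_of_cast_add_mul_eq {n d N R : ℕ} (hn : N * (2 * R) < n) (hd : 0 < d) (hdN : d ≤ N)
    {b : ZMod n} {x x' : ℤ} (hx : |x| ≤ R) (hx' : |x'| ≤ R)
    (h : b + d • (x : ZMod n) = b + d • (x' : ZMod n)) : x = x' := by
  have h1 : ((d * (x - x') : ℤ) : ZMod n) = 0 := by
    have := add_left_cancel h
    simp only [nsmul_eq_mul] at this
    push_cast
    rw [mul_sub, this, sub_self]
  rw [ZMod.intCast_zmod_eq_zero_iff_dvd] at h1
  have h2 : |(d * (x - x') : ℤ)| < n := by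
    rw [abs_mul, Nat.abs_cast]
    have h3 : |x - x'| ≤ 2 * R := (abs_sub _ _).trans (by linarith)
    calc (d : ℤ) * |x - x'| ≤ N * (2 * R) := by gcongr
      _ < n := by exact_mod_cast hn
  have h4 := Int.eq_zero_of_abs_lt_dvd h1 h2
  have h5 : (d : ℤ) ≠ 0 := by exact_mod_cast hd.ne'
  linarith [(mul_eq_zero.1 h4).resolve_left h5]

theorem stmt_3 (k : ℕ) (hk : 3 ≤ k) (c : ℝ) (hc : 0 < c) :
    ∃ n₀ : ℕ, ∀ n : ℕ, n₀ ≤ n →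
      ∀ S : Finset (ZMod n × ZMod n), c * (n : ℝ) ^ 2 ≤ (S.card : ℝ) →
        ∃ T : Finset (ZMod n), T.card ≤ gmin k ∧
          k ≤ (S.filter (fun p => p.1 ∈ T ∧ p.2 ∈ T ∧ p.1 + p.2 ∈ T)).card := by
  classical
  obtain ⟨P, hPk, hPg⟩ := exists_gP_eq_gmin k
  obtain ⟨p₀, hp₀⟩ : P.Nonempty := Finset.card_pos.1 (by omega)
  have : Nonempty P := ⟨⟨p₀, hp₀⟩⟩
  obtain ⟨N, hN⟩ := Combinatorics.exists_dilate_subset (α := P) hc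
  set R : ℕ := P.sup fun p => p.1.natAbs + p.2.natAbs with hR
  have hbound : ∀ p ∈ P, |p.1| ≤ R ∧ |p.2| ≤ R := fun p hp => by
    have : p.1.natAbs + p.2.natAbs ≤ R :=
      Finset.le_sup (f := fun p : ℤ × ℤ => p.1.natAbs + p.2.natAbs) hp
    rw [Int.abs_eq_natAbs, Int.abs_eq_natAbs]
    omega
  refine ⟨N * (2 * R) + 1, fun n hn S hS => ?_⟩
  have : NeZero n := ⟨by omega⟩
  have hn0 : (0 : ℝ) < n := by exact_mod_cast Nat.pos_of_ne_zero (NeZero.ne n)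
  have hdens : c ≤ uniformDensity (S : Set (ZMod n × ZMod n)) := by
    have hsum : ∑ x, (S : Set (ZMod n × ZMod n)).indicator (1 : _ × _ → ℝ) x = S.card := by
      simp [Set.indicator_apply]
    rw [uniformDensity, Fintype.expect_eq_sum_div_card, hsum, Fintype.card_prod, ZMod.card,
      Nat.cast_mul, le_div_iff₀ (by positivity)]
    linarith
  obtain ⟨b, d, hd0, hdN, hbd⟩ := hN (ZMod n × ZMod n)
    (fun p => ((p.1.1 : ZMod n), (p.1.2 : ZMod n))) S hdens
  refine ⟨(P.image Prod.fst).image (fun x : ℤ => b.1 + d • (x : ZMod n)) ∪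
    (P.image Prod.snd).image (fun x : ℤ => b.2 + d • (x : ZMod n)) ∪
    (P.image fun p => p.1 + p.2).image (fun x : ℤ => b.1 + b.2 + d • (x : ZMod n)), ?_, ?_⟩
  · rw [← hPg, gP]
    refine (Finset.card_union_le _ _).trans (add_le_add ?_ Finset.card_image_le)
    exact (Finset.card_union_le _ _).trans (add_le_add Finset.card_image_le Finset.card_image_le)
  · rw [← hPk]
    refine Finset.card_le_card_of_injOn
      (fun p => (b.1 + d • (p.1 : ZMod n), b.2 + d • (p.2 : ZMod n))) (fun p hp => ?_) ?_
    · simp only [Finset.coe_filter, Set.mem_ofPred_eq, Finset.mem_union, Finset.mem_image,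
        exists_exists_and_eq_and]
      refine ⟨hbd ⟨p, hp⟩, .inl (.inl ⟨p, hp, rfl⟩), .inl (.inr ⟨p, hp, rfl⟩), .inr ⟨p, hp, ?_⟩⟩
      push_cast
      rw [smul_add]
      abel
    · intro p hp q hq hpq
      rw [Prod.mk.injEq] at hpq
      exact Prod.ext
        (eq_of_cast_add_mul_eq hn hd0 hdN (hbound p hp).1 (hbound q hq).1 hpq.1)
        (eq_of_cast_add_mul_eq hn hd0 hdN (hbound p hp).2 (hbound q hq).2 hpq.2)
end

section
/- For every integer k ≥ 3 there exists n₀ ∈ ℕ such that for every n ≥ n₀ there exists a set S ⊆ (ℤ/nℤ) × (ℤ/nℤ) with |S| ≥ n²/64 such that every subset T ⊆ ℤ/nℤ with |T| ≤ g(k) − 1 satisfies: the number of pairs (a,b) ∈ S with a ∈ T, b ∈ T and a + b ∈ T is strictly less than k. -/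
theorem gmin_le_gP {k : ℕ} {P : Finset (ℤ × ℤ)} (hP : P.card = k) : gmin k ≤ gP P :=
  Nat.sInf_le ⟨P, hP, rfl⟩

/-- If the coordinates and the coordinate sums of `P` lie in three consecutive disjoint ranges,
then `gP P` is at most the size of any set containing all of them. -/
theorem gP_le_card_of_separated {P : Finset (ℤ × ℤ)} {V : Finset ℤ} {u v : ℤ}
    (hsep : ∀ p ∈ P, p.1 < u ∧ u ≤ p.2 ∧ p.2 < v ∧ v ≤ p.1 + p.2)
    (hV : ∀ p ∈ P, p.1 ∈ V ∧ p.2 ∈ V ∧ p.1 + p.2 ∈ V) : gP P ≤ V.card := by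
  have h₁ : Disjoint (P.image Prod.fst) (P.image Prod.snd) := by
    simp only [Finset.disjoint_left, Finset.mem_image]
    rintro _ ⟨p, hp, rfl⟩ ⟨q, hq, h⟩
    have := hsep p hp
    have := hsep q hq
    omega
  have h₂ : Disjoint (P.image Prod.fst ∪ P.image Prod.snd)
      (P.image fun p => p.1 + p.2) := by
    simp only [Finset.disjoint_left, Finset.mem_union, Finset.mem_image]
    rintro _ (⟨p, hp, rfl⟩ | ⟨p, hp, rfl⟩) ⟨q, hq, h⟩ <;>
    · have := hsep p hp
      have := hsep q hq
      omega
  rw [gP, ← Finset.card_union_of_disjoint h₁, ← Finset.card_union_of_disjoint h₂]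
  refine Finset.card_le_card (Finset.union_subset (Finset.union_subset ?_ ?_) ?_) <;>
  · intro x hx
    obtain ⟨p, hp, rfl⟩ := Finset.mem_image.1 hx
    have := hV p hp
    tauto

/-- The pairs in `ZMod n` whose coordinates have representatives in `[m, 2m)` and `[2m, 3m)`. -/
def intervalPairs (n m : ℕ) [NeZero n] : Finset (ZMod n × ZMod n) :=
  Finset.univ.filter fun p =>
    (m ≤ p.1.val ∧ p.1.val < 2 * m) ∧ 2 * m ≤ p.2.val ∧ p.2.val < 3 * m

theorem mul_self_le_card_intervalPairs {n m : ℕ} [NeZero n] (h : 3 * m ≤ n) :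
    m * m ≤ (intervalPairs n m).card := by
  have hcard : (Finset.Ico m (2 * m) ×ˢ Finset.Ico (2 * m) (3 * m)).card = m * m := by
    rw [Finset.card_product, Nat.card_Ico, Nat.card_Ico]
    congr 1 <;> omega
  rw [← hcard]
  refine Finset.card_le_card_of_injOn (fun p => ((p.1 : ZMod n), (p.2 : ZMod n))) ?_ ?_
  · rintro ⟨a, b⟩ hp
    simp only [Finset.coe_product, Set.mem_prod, Finset.mem_coe, Finset.mem_Ico] at hp
    simp only [intervalPairs, Finset.coe_filter, Finset.mem_univ, true_and, Set.mem_ofPred_eq]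
    rwa [ZMod.val_cast_of_lt (by omega : a < n), ZMod.val_cast_of_lt (by omega : b < n)]
  · rintro ⟨a, b⟩ hp ⟨c, d⟩ hq heq
    simp only [Finset.coe_product, Set.mem_prod, Finset.mem_coe, Finset.mem_Ico] at hp hq
    obtain ⟨h₁, h₂⟩ := Prod.mk.inj heq
    have h₁ := congrArg ZMod.val h₁
    have h₂ := congrArg ZMod.val h₂
    rw [ZMod.val_cast_of_lt (by omega), ZMod.val_cast_of_lt (by omega)] at h₁ h₂
    exact Prod.ext h₁ h₂

theorem gmin_le_card_of_spans {n m : ℕ} [NeZero n] (h : 5 * m ≤ n + 1)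
    {Q : Finset (ZMod n × ZMod n)} (hQ : Q ⊆ intervalPairs n m) {T : Finset (ZMod n)}
    (hT : ∀ p ∈ Q, p.1 ∈ T ∧ p.2 ∈ T ∧ p.1 + p.2 ∈ T) : gmin Q.card ≤ T.card := by
  let val : ZMod n → ℤ := fun a => (a.val : ℤ)
  have hinj : Function.Injective val := fun a b hab =>
    ZMod.val_injective n (Int.ofNat_inj.1 hab)
  have hbounds : ∀ p ∈ Q,
      (m ≤ p.1.val ∧ p.1.val < 2 * m) ∧ 2 * m ≤ p.2.val ∧ p.2.val < 3 * m :=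
    fun p hp => (Finset.mem_filter.1 (hQ hp)).2
  calc gmin Q.card ≤ gP (Q.image (Prod.map val val)) :=
        gmin_le_gP (Finset.card_image_of_injective _ (hinj.prodMap hinj))
    _ ≤ (T.image val).card := by
        refine gP_le_card_of_separated (u := 2 * m) (v := 3 * m) ?_ ?_ <;>
        · intro q hq
          obtain ⟨p, hp, rfl⟩ := Finset.mem_image.1 hq
          have hb := hbounds p hp
          simp only [Prod.map_fst, Prod.map_snd]
          first
          | simp only [val]
            omega
          | obtain ⟨h₁, h₂, h₃⟩ := hT p hp
            refine ⟨Finset.mem_image_of_mem _ h₁, Finset.mem_image_of_mem _ h₂, ?_⟩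
            have hadd : val p.1 + val p.2 = val (p.1 + p.2) := by
              simp only [val]
              rw [ZMod.val_add_of_lt (by omega), Nat.cast_add]
            rw [hadd]
            exact Finset.mem_image_of_mem _ h₃
    _ ≤ T.card := Finset.card_image_le

theorem stmt_4 (k : ℕ) (hk : 3 ≤ k) :
    ∃ n₀ : ℕ, ∀ n : ℕ, n₀ ≤ n →
      ∃ S : Finset (ZMod n × ZMod n), (n : ℝ) ^ 2 / 64 ≤ (S.card : ℝ) ∧
        ∀ T : Finset (ZMod n), T.card ≤ gmin k - 1 →
          (S.filter (fun p => p.1 ∈ T ∧ p.2 ∈ T ∧ p.1 + p.2 ∈ T)).card < k := by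
  refine ⟨9, fun n hn => ?_⟩
  have : NeZero n := ⟨by omega⟩
  obtain ⟨m, hm, hm'⟩ : ∃ m, n ≤ 8 * m ∧ 5 * m ≤ n + 1 := ⟨(n + 7) / 8, by omega, by omega⟩
  refine ⟨intervalPairs n m, ?_, fun T hT => ?_⟩
  · have hcard : ((m * m : ℕ) : ℝ) ≤ (intervalPairs n m).card :=
      Nat.cast_le.2 (mul_self_le_card_intervalPairs (by omega))
    have hnm : (n : ℝ) ≤ 8 * m := by exact_mod_cast hm
    push_cast at hcard
    nlinarith [(Nat.cast_nonneg n : (0 : ℝ) ≤ n)]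
  · by_contra! hcon
    obtain ⟨Q, hQ, rfl⟩ := Finset.exists_subset_card_eq hcon
    have hspan : ∀ p ∈ Q, p.1 ∈ T ∧ p.2 ∈ T ∧ p.1 + p.2 ∈ T :=
      fun p hp => (Finset.mem_filter.1 (hQ hp)).2
    have hle := gmin_le_card_of_spans hm' (hQ.trans (Finset.filter_subset _ _)) hspan
    obtain ⟨p, hp⟩ : Q.Nonempty := Finset.card_pos.1 (by omega)
    have hpos : 0 < T.card := Finset.card_pos.2 ⟨_, (hspan p hp).1⟩
    omega
end

section
/- g(k) = (1 + o(1))·√(12k), i.e. for every ε > 0 there exists k₀ such that for all k ≥ k₀ one has (1 − ε)·√(12k) ≤ g(k) ≤ (1 + ε)·√(12k). -/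
/-- In a finite subset of a linear order, at most `s.card - t` elements have `t` or more
elements of `s` below them. -/
theorem card_filter_le_card_lt {α : Type*} [LinearOrder α] (s : Finset α) (t : ℕ) :
    (s.filter (fun x => t ≤ (s.filter (· < x)).card)).card ≤ s.card - t := by
  rw [← Nat.card_Ico]
  apply Finset.card_le_card_of_injOn (fun x => (s.filter (· < x)).card)
  · intro x hx
    simp only [Finset.coe_filter, Set.mem_ofPred_eq] at hx
    simp only [Finset.coe_Ico, Set.mem_Ico]
    refine ⟨hx.2, Finset.card_lt_card ?_⟩
    rw [Finset.ssubset_iff_of_subset (Finset.filter_subset _ _)]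
    exact ⟨x, hx.1, by simp⟩
  · have key : ∀ x ∈ s, ∀ y, x < y → (s.filter (· < x)).card < (s.filter (· < y)).card := by
      intro x hx y hxy
      apply Finset.card_lt_card
      rw [Finset.ssubset_iff_of_subset]
      · exact ⟨x, by simp [hx, hxy], by simp⟩
      · intro z hz
        simp only [Finset.mem_filter] at hz ⊢
        exact ⟨hz.1, hz.2.trans hxy⟩
    intro x hx y hy hxy
    simp only [Finset.coe_filter, Set.mem_ofPred_eq] at hx hy
    dsimp only at hxy
    rcases lt_trichotomy x y with h | h | h
    · have := key x hx.1 y h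
      omega
    · exact h
    · have := key y hy.1 x h
      omega

/-- A Pollard-type inequality for points in the plane. -/
theorem card_le_mul_add_mul (P : Finset (ℤ × ℤ)) (t : ℕ) :
    P.card ≤ t * (P.image (fun p => p.1 + p.2)).card +
      ((P.image Prod.fst).card - t) * ((P.image Prod.snd).card - t) := by
  set idx : ℤ × ℤ → ℕ := fun p =>
    (P.filter (fun q => q.1 + q.2 = p.1 + p.2 ∧ q.1 < p.1)).card with hidx
  rw [← Finset.card_filter_add_card_filter_not (s := P) (fun p => idx p < t)]
  apply add_le_add
  · refine (Finset.card_le_mul_card_image (f := fun p : ℤ × ℤ => p.1 + p.2) _ t ?_).trans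
      (Nat.mul_le_mul_left _ (Finset.card_le_card
        (Finset.image_subset_image (Finset.filter_subset _ _))))
    intro c _
    rw [← Finset.card_range t]
    apply Finset.card_le_card_of_injOn idx
    · intro p hp
      simp only [Finset.coe_filter, Finset.mem_filter, Set.mem_ofPred_eq] at hp
      simpa using hp.1.2
    · have key : ∀ p ∈ P, ∀ q, p.1 + p.2 = q.1 + q.2 → p.1 < q.1 → idx p < idx q := by
        intro p hp q hpq hlt
        apply Finset.card_lt_card
        rw [Finset.ssubset_iff_of_subset]
        · exact ⟨p, by simp [hp, hpq, hlt], by simp⟩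
        · intro z hz
          simp only [Finset.mem_filter] at hz ⊢
          exact ⟨hz.1, by omega, by omega⟩
      intro p hp q hq hpq
      simp only [Finset.coe_filter, Finset.mem_filter, Set.mem_ofPred_eq] at hp hq
      rcases lt_trichotomy p.1 q.1 with h | h | h
      · have := key p hp.1.1 q (by omega) h
        omega
      · ext <;> omega
      · have := key q hq.1.1 p (by omega) h
        omega
  · have hA := card_filter_le_card_lt (P.image Prod.fst) t
    have hB : ((P.image Prod.snd).filter
        (fun y => t ≤ ((P.image Prod.snd).filter (y < ·)).card)).card ≤
          (P.image Prod.snd).card - t :=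
      card_filter_le_card_lt (α := ℤᵒᵈ) (P.image Prod.snd) t
    refine le_trans ?_ (Nat.mul_le_mul hA hB)
    rw [← Finset.card_product]
    apply Finset.card_le_card
    intro p hp
    simp only [Finset.mem_filter, not_lt] at hp
    obtain ⟨hp, ht⟩ := hp
    refine Finset.mem_product.2 ⟨Finset.mem_filter.2 ⟨Finset.mem_image_of_mem _ hp, ht.trans ?_⟩,
      Finset.mem_filter.2 ⟨Finset.mem_image_of_mem _ hp, ht.trans ?_⟩⟩
    · apply Finset.card_le_card_of_injOn Prod.fst
      · intro q hq
        simp only [Finset.coe_filter, Set.mem_ofPred_eq] at hq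
        exact Finset.mem_filter.2 ⟨Finset.mem_image_of_mem _ hq.1, hq.2.2⟩
      · intro q hq r hr h
        simp only [Finset.coe_filter, Set.mem_ofPred_eq] at hq hr
        ext <;> omega
    · apply Finset.card_le_card_of_injOn Prod.snd
      · intro q hq
        simp only [Finset.coe_filter, Set.mem_ofPred_eq] at hq
        exact Finset.mem_filter.2 ⟨Finset.mem_image_of_mem _ hq.1, by omega⟩
      · intro q hq r hr h
        simp only [Finset.coe_filter, Set.mem_ofPred_eq] at hq hr
        ext <;> omega

theorem twelve_mul_card_le_gP_sq (P : Finset (ℤ × ℤ)) : 12 * P.card ≤ gP P ^ 2 + 3 := by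
  have key := card_le_mul_add_mul P
  unfold gP
  generalize (P.image Prod.fst).card = a at *
  generalize (P.image Prod.snd).card = b at *
  generalize (P.image (fun p => p.1 + p.2)).card = c at *
  generalize P.card = k at *
  by_cases h₁ : a + b ≤ c
  · have h := key 0
    simp only [zero_mul, zero_add, Nat.sub_zero] at h
    zify at *
    nlinarith [sq_nonneg ((a : ℤ) - b)]
  by_cases h₂ : a + c ≤ b
  · have h := key a
    simp only [Nat.sub_self, zero_mul, add_zero] at h
    zify at *
    nlinarith [sq_nonneg ((a : ℤ) - c)]
  by_cases h₃ : b + c ≤ a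
  · have h := key b
    simp only [Nat.sub_self, mul_zero, add_zero] at h
    zify at *
    nlinarith [sq_nonneg ((b : ℤ) - c)]
  obtain ⟨t, ht⟩ : ∃ t, a + b - c = 2 * t ∨ a + b - c = 2 * t + 1 :=
    ⟨(a + b - c) / 2, by omega⟩
  have h := key t
  obtain ⟨u, rfl⟩ : ∃ u, a = t + u := ⟨a - t, by omega⟩
  obtain ⟨v, rfl⟩ : ∃ v, b = t + v := ⟨b - t, by omega⟩
  simp only [Nat.add_sub_cancel_left] at h
  rcases ht with ht | ht
  · obtain rfl : c = u + v := by omega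
    zify at *
    nlinarith [sq_nonneg ((u : ℤ) - v), sq_nonneg ((u : ℤ) + v - 2 * t),
      sq_nonneg ((u : ℤ) - t), sq_nonneg ((v : ℤ) - t)]
  · have hc : c + 1 = u + v := by omega
    zify at *
    have hc' : (c : ℤ) = u + v - 1 := by omega
    rw [hc'] at h ⊢
    nlinarith [sq_nonneg ((u : ℤ) - v), sq_nonneg ((u : ℤ) - t - 1), sq_nonneg ((v : ℤ) - t - 1)]

theorem gP_mono {P Q : Finset (ℤ × ℤ)} (h : P ⊆ Q) : gP P ≤ gP Q := by
  unfold gP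
  gcongr

/-- Every `k ≤ 3 n ^ 2` is the size of a subset of the hexagon of side `n`. -/
theorem gmin_le {n k : ℕ} (h : k ≤ 3 * n ^ 2) : gmin k ≤ 6 * n + 3 := by
  set R : Finset (ℤ × ℤ) := Finset.Ico (0 : ℤ) n ×ˢ Finset.Ioc (0 : ℤ) n with hR
  have hRc : R.card = n ^ 2 := by simp [hR, sq]
  set S₁ := R.image (fun p => (p.1 - p.2, p.2)) with hS₁
  set S₂ := R.image (fun p => (-p.1, p.1 - p.2)) with hS₂
  set S₃ := R.image (fun p => (p.2, -p.1)) with hS₃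
  have h₁ : S₁.card = n ^ 2 := by
    rw [hS₁, Finset.card_image_of_injective, hRc]
    intro p q hpq
    simp only [Prod.mk.injEq] at hpq
    ext <;> omega
  have h₂ : S₂.card = n ^ 2 := by
    rw [hS₂, Finset.card_image_of_injective, hRc]
    intro p q hpq
    simp only [Prod.mk.injEq] at hpq
    ext <;> omega
  have h₃ : S₃.card = n ^ 2 := by
    rw [hS₃, Finset.card_image_of_injective, hRc]
    intro p q hpq
    simp only [Prod.mk.injEq] at hpq
    ext <;> omega
  have m₁ : ∀ p ∈ S₁, p.1 ≤ n ∧ -n ≤ p.1 ∧ 0 < p.2 ∧ p.2 ≤ n ∧ 0 ≤ p.1 + p.2 ∧ p.1 + p.2 ≤ n := by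
    intro p hp
    simp only [hS₁, hR, Finset.mem_image, Finset.mem_product, Finset.mem_Ico,
      Finset.mem_Ioc] at hp
    obtain ⟨q, hq, rfl⟩ := hp
    dsimp only
    omega
  have m₂ : ∀ p ∈ S₂, p.1 ≤ 0 ∧ -n ≤ p.1 ∧ -n ≤ p.2 ∧ p.2 ≤ n ∧ -n ≤ p.1 + p.2 ∧
      p.1 + p.2 < 0 := by
    intro p hp
    simp only [hS₂, hR, Finset.mem_image, Finset.mem_product, Finset.mem_Ico,
      Finset.mem_Ioc] at hp
    obtain ⟨q, hq, rfl⟩ := hp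
    dsimp only
    omega
  have m₃ : ∀ p ∈ S₃, 0 < p.1 ∧ p.1 ≤ n ∧ -n ≤ p.2 ∧ p.2 ≤ 0 ∧ -n ≤ p.1 + p.2 ∧
      p.1 + p.2 ≤ n := by
    intro p hp
    simp only [hS₃, hR, Finset.mem_image, Finset.mem_product, Finset.mem_Ico,
      Finset.mem_Ioc] at hp
    obtain ⟨q, hq, rfl⟩ := hp
    dsimp only
    omega
  have hcard : (S₁ ∪ S₂ ∪ S₃).card = 3 * n ^ 2 := by
    rw [Finset.card_union_of_disjoint, Finset.card_union_of_disjoint, h₁, h₂, h₃]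
    · ring
    · rw [Finset.disjoint_left]
      intro p hp hp'
      have := m₁ p hp
      have := m₂ p hp'
      omega
    · rw [Finset.disjoint_left]
      intro p hp hp'
      have := m₃ p hp'
      rcases Finset.mem_union.1 hp with hp | hp
      · have := m₁ p hp
        omega
      · have := m₂ p hp
        omega
  have hm : ∀ p ∈ S₁ ∪ S₂ ∪ S₃, p.1 ∈ Finset.Icc (-n : ℤ) n ∧ p.2 ∈ Finset.Icc (-n : ℤ) n ∧
      p.1 + p.2 ∈ Finset.Icc (-n : ℤ) n := by
    intro p hp
    simp only [Finset.mem_Icc]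
    rw [Finset.mem_union, Finset.mem_union] at hp
    rcases hp with (hp | hp) | hp
    · have := m₁ p hp
      omega
    · have := m₂ p hp
      omega
    · have := m₃ p hp
      omega
  have hI : (Finset.Icc (-n : ℤ) n).card = 2 * n + 1 := by
    rw [Int.card_Icc]
    omega
  obtain ⟨P, hP, hPk⟩ := Finset.exists_subset_card_eq (hcard ▸ h)
  have hle : gmin k ≤ gP P := Nat.sInf_le ⟨P, hPk, rfl⟩
  have e₁ := Finset.card_le_card (Finset.image_subset_iff.2 fun p hp => (hm p hp).1)
  have e₂ := Finset.card_le_card (Finset.image_subset_iff.2 fun p hp => (hm p hp).2.1)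
  have e₃ := Finset.card_le_card (Finset.image_subset_iff.2 fun p hp => (hm p hp).2.2)
  have := gP_mono hP
  unfold gP at this hle
  omega

theorem twelve_mul_le_gmin_sq (k : ℕ) : 12 * k ≤ gmin k ^ 2 + 3 := by
  obtain ⟨P, hP⟩ := Infinite.exists_subset_card_eq (ℤ × ℤ) k
  obtain ⟨Q, hQ, hg⟩ : gmin k ∈ {m | ∃ P : Finset (ℤ × ℤ), P.card = k ∧ gP P = m} :=
    Nat.sInf_mem ⟨gP P, P, hP, rfl⟩
  rw [← hg, ← hQ]
  exact twelve_mul_card_le_gP_sq Q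

/-- `g(k) = (1 + o(1)) √(12k)`. -/
theorem stmt_5 : ∀ ε : ℝ, 0 < ε → ∃ k₀ : ℕ, ∀ k : ℕ, k₀ ≤ k →
    (1 - ε) * Real.sqrt (12 * k) ≤ (gmin k : ℝ) ∧
    (gmin k : ℝ) ≤ (1 + ε) * Real.sqrt (12 * k) := by
  intro ε hε
  obtain ⟨k₀, hk₀⟩ := exists_nat_ge (max (1 / ε) ((9 / ε) ^ 2))
  refine ⟨k₀, fun k hk => ?_⟩
  have hk' : (k₀ : ℝ) ≤ k := by exact_mod_cast hk
  have hk₁ : 1 / ε ≤ k := (le_max_left _ _).trans (hk₀.trans hk')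
  have hk₂ : (9 / ε) ^ 2 ≤ k := (le_max_right _ _).trans (hk₀.trans hk')
  have hs : Real.sqrt (12 * k) ^ 2 = 12 * k := Real.sq_sqrt (by positivity)
  have hs₀ := Real.sqrt_nonneg (12 * (k : ℝ))
  constructor
  · rcases le_or_gt 1 ε with h | h
    · exact (mul_nonpos_of_nonpos_of_nonneg (by linarith) hs₀).trans (Nat.cast_nonneg _)
    · have hlow : (12 * k : ℝ) ≤ (gmin k : ℝ) ^ 2 + 3 := by
        exact_mod_cast twelve_mul_le_gmin_sq k
      have hεk : 1 ≤ k * ε := (div_le_iff₀ hε).1 hk₁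
      refine abs_le_of_sq_le_sq' ?_ (Nat.cast_nonneg _) |>.2
      rw [mul_pow, hs]
      nlinarith [mul_nonneg (by linarith : (0 : ℝ) ≤ 1 - ε) (by linarith : (0 : ℝ) ≤ k * ε)]
  · have hn := Nat.le_ceil (Real.sqrt (12 * k) / 6)
    have hn' := Nat.ceil_lt_add_one (div_nonneg hs₀ (by norm_num : (0 : ℝ) ≤ 6))
    set n := ⌈Real.sqrt (12 * k) / 6⌉₊
    have hkn : k ≤ 3 * n ^ 2 := by
      have : (k : ℝ) ≤ 3 * n ^ 2 := by nlinarith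
      exact_mod_cast this
    have hup : (gmin k : ℝ) ≤ 6 * n + 3 := by exact_mod_cast gmin_le hkn
    have h9 : 9 / ε ≤ Real.sqrt (12 * k) := by
      apply Real.le_sqrt_of_sq_le
      linarith [(Nat.cast_nonneg k : (0 : ℝ) ≤ k)]
    have := (div_le_iff₀ hε).1 h9
    linarith
end
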